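/- arXiv:2101.03145 — 3 statements merged into one kernel-verified Lean document; each statement's English description precedes it below -/
import Mathlib

section
/- Let k be a number field whose 2-class group (the 2-Sylow subgroup of the ideal class group) is cyclic, and let K/k be a quadratic extension that is unramified at all finite and infinite places. Then every unit of k is the relative norm of a unit of K, i.e. E_k = N_{K/k}E_K. -/
open NumberField
open scoped Classical

/-- A prime ideal `𝔭` of `F` is ramified in `K` if some prime of `K` appears at least
twice in the factorization of `𝔭 O_K`. -/
def IsRamifiedIn (F K : Type*) [Field F] [NumberField F] [Field K] [NumberField K]
    [Algebra F K] (𝔭 : Ideal (𝓞 F)) : Prop :=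
  ∃ 𝔓 : Ideal (𝓞 K), 𝔓.IsPrime ∧ 𝔓 ^ 2 ∣ Ideal.map (algebraMap (𝓞 F) (𝓞 K)) 𝔭

/-- `K/F` is unramified at all infinite places: every real embedding of `F`
extends to a real embedding of `K`. -/
def UnramifiedAtInfinitePlaces (F K : Type*) [Field F] [Field K] [Algebra F K] : Prop :=
  ∀ φ : F →+* ℝ, ∃ ψ : K →+* ℝ, ψ.comp (algebraMap F K) = φ

/-- The subgroup `N_{K/F} E_K` of norms of units, inside the unit group `E_F`. -/
noncomputable def relUnitNormRange (F K : Type*) [Field F] [NumberField F] [Field K]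
    [NumberField K] [Algebra F K] : Subgroup (𝓞 F)ˣ :=
  (Units.map (RingOfIntegers.norm F : 𝓞 K →* 𝓞 F)).range

theorem card_ker_two {G : Type*} [CommGroup G] (g : G) (hg : g ≠ 1)
    (h : ∀ x : G, x ^ 2 = 1 ↔ x = 1 ∨ x = g) :
    Nat.card (powMonoidHom 2 : G →* G).ker = 2 := by
  have : ((powMonoidHom 2 : G →* G).ker : Set G) = {1, g} := by
    ext x
    simp [MonoidHom.mem_ker, h]
  change Nat.card ((powMonoidHom 2 : G →* G).ker : Set G) = 2
  rw [this, Nat.card_coe_set_eq, Set.ncard_pair hg.symm]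

theorem two_torsion_le {G : Type*} [CommGroup G] [Finite G]
    (hcyc : ∀ P : Sylow 2 G, IsCyclic (P : Subgroup G)) :
    Nat.card {c : G // c ^ 2 = 1} ≤ 2 := by
  have hp : IsPGroup 2 (powMonoidHom 2 : G →* G).ker := by
    rintro ⟨x, hx⟩
    exact ⟨1, by ext1; simpa [MonoidHom.mem_ker] using hx⟩
  obtain ⟨Q, hQ⟩ := hp.exists_le_sylow
  have := hcyc Q
  have := Fintype.ofFinite (Q : Subgroup G)
  have h := IsCyclic.card_pow_eq_one_le (α := (Q : Subgroup G)) (n := 2) (by norm_num)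
  refine le_trans ?_ h
  rw [← Fintype.card_coe, ← Nat.card_eq_fintype_card]
  refine Nat.card_le_card_of_injective
    (fun c => ⟨⟨c.1, hQ (by simpa [MonoidHom.mem_ker] using c.2)⟩, by simp [Subtype.ext_iff, c.2]⟩) ?_
  intro a b hab
  simpa [Subtype.ext_iff] using hab

theorem unram_inf (k K : Type*) [Field k] [Field K] [Algebra k K] [IsGalois k K]
    (hinf : ∀ φ : k →+* ℝ, ∃ ψ : K →+* ℝ, ψ.comp (algebraMap k K) = φ) :
    IsUnramifiedAtInfinitePlaces k K := by
  refine ⟨fun w => ?_⟩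
  rw [InfinitePlace.isUnramified_iff]
  by_cases h : (w.comap (algebraMap k K)).IsReal
  swap
  · right; exact InfinitePlace.not_isReal_iff_isComplex.1 h
  left
  obtain ⟨φ, hφ, hv⟩ := h
  obtain ⟨ψ, hψ⟩ := hinf hφ.embedding
  have e : (InfinitePlace.mk (Complex.ofRealHom.comp ψ)).comap (algebraMap k K)
      = w.comap (algebraMap k K) := by
    rw [← hv, InfinitePlace.comap_mk, RingHom.comp_assoc, hψ]
    congr 1
    ext x
    simp
  obtain ⟨σ, rfl⟩ := InfinitePlace.exists_smul_eq_of_comap_eq e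
  rw [InfinitePlace.isReal_smul_iff]
  refine ⟨_, ?_, rfl⟩
  rw [ComplexEmbedding.isReal_iff]
  ext x
  simp

theorem invariant_ideal (k K : Type*) [Field k] [NumberField k] [Field K] [NumberField K]
    [Algebra k K] [IsGalois k K]
    (hram : ∀ 𝔮 : Ideal (𝓞 k), 𝔮.IsPrime → 𝔮 ≠ ⊥ → ¬ ∃ 𝔓 : Ideal (𝓞 K), 𝔓.IsPrime ∧
       𝔓 ^ 2 ∣ Ideal.map (algebraMap (𝓞 k) (𝓞 K)) 𝔮) (J : Ideal (𝓞 K)) :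
    J ≠ ⊥ → (∀ g : Gal(K/k), J.map (galRestrict (𝓞 k) k K (𝓞 K) g : 𝓞 K →+* 𝓞 K) ≤ J) →
    ∃ I : Ideal (𝓞 k), I.map (algebraMap (𝓞 k) (𝓞 K)) = J := by
  induction J using IsNoetherian.induction with
  | _ J ih =>
  intro hJ hinv
  by_cases htop : J = ⊤
  · exact ⟨⊤, by rw [htop, Ideal.map_top]⟩
  obtain ⟨P, hPm, hP⟩ := Ideal.exists_le_maximal J htop
  set p := P.under (𝓞 k) with hp
  have hP0 : P ≠ ⊥ := fun h => hJ (le_bot_iff.1 (h ▸ hP))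
  have hp0 : p ≠ ⊥ := Ideal.under_ne_bot _ hP0
  have hpp : p.IsPrime := inferInstance
  have hpm : p.IsMaximal := hpp.isMaximal hp0
  have hm0 : p.map (algebraMap (𝓞 k) (𝓞 K)) ≠ ⊥ := by
    rwa [Ne, Ideal.map_eq_bot_iff_of_injective (FaithfulSMul.algebraMap_injective _ _)]
  have hsq : Squarefree (p.map (algebraMap (𝓞 k) (𝓞 K))) := by
    rw [squarefree_iff_no_irreducibles hm0]
    intro Q hQ hd
    exact hram p hpp hp0 ⟨Q, Ideal.isPrime_of_prime hQ.prime, by rwa [sq]⟩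
  have hdvd : p.map (algebraMap (𝓞 k) (𝓞 K)) ∣ J := by
    rw [UniqueFactorizationMonoid.dvd_iff_normalizedFactors_le_normalizedFactors hm0 hJ,
      Multiset.le_iff_subset ((UniqueFactorizationMonoid.squarefree_iff_nodup_normalizedFactors
        hm0).1 hsq)]
    intro Q hQ
    rw [Ideal.mem_normalizedFactors_iff hm0] at hQ
    rw [Ideal.mem_normalizedFactors_iff hJ]
    refine ⟨hQ.1, ?_⟩
    have := hQ.1
    have hQp : p = Q.under (𝓞 k) :=
      hpm.eq_of_le (Ideal.IsPrime.under _ _).ne_top (Ideal.map_le_iff_le_comap.1 hQ.2)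
    obtain ⟨g, hg⟩ := Ideal.exists_comap_galRestrict_eq (𝓞 k) k K (𝓞 K) (p := p) (P₁ := P)
      (P₂ := Q) ⟨inferInstance, ⟨rfl⟩⟩ ⟨hQ.1, ⟨hQp⟩⟩
    rw [← hg]
    exact Ideal.map_le_iff_le_comap.1 ((hinv g).trans hP)
  obtain ⟨J', rfl⟩ := hdvd
  have hJ' : J' ≠ ⊥ := by rintro rfl; simp at hJ
  have hlt : J' > p.map (algebraMap (𝓞 k) (𝓞 K)) * J' := by
    refine lt_of_le_of_ne Ideal.mul_le_right ?_
    intro h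
    have : p.map (algebraMap (𝓞 k) (𝓞 K)) = 1 := by
      apply mul_right_cancel₀ hJ'
      rw [one_mul]; exact h
    have h2 : p.map (algebraMap (𝓞 k) (𝓞 K)) ≤ P := Ideal.map_comap_le
    rw [this] at h2
    exact hPm.ne_top (top_le_iff.1 (by simpa using h2))
  obtain ⟨I, hI⟩ := ih J' hlt hJ' (by
    intro g
    have h := hinv g
    rw [Ideal.map_mul, Ideal.map_map, ← Ideal.dvd_iff_le] at h
    have e : ((galRestrict (𝓞 k) k K (𝓞 K) g : 𝓞 K →+* 𝓞 K)).comp (algebraMap (𝓞 k) (𝓞 K))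
        = algebraMap (𝓞 k) (𝓞 K) := by
      ext1 x
      exact (galRestrict (𝓞 k) k K (𝓞 K) g).commutes x
    rw [e] at h
    exact Ideal.dvd_iff_le.1 ((mul_dvd_mul_iff_left hm0).1 h))
  exact ⟨p * I, by rw [Ideal.map_mul, hI]⟩

theorem idx_prod {A B : Type*} [AddCommGroup A] [AddCommGroup B] :
   (nsmulAddMonoidHom 2 : A × B →+ A × B).range = 
    (nsmulAddMonoidHom 2 : A →+ A).range.prod (nsmulAddMonoidHom 2 : B →+ B).range := by
  ext ⟨a, b⟩
  simp [AddSubgroup.mem_prod, Prod.ext_iff]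

theorem idx_equiv {A B : Type*} [AddCommGroup A] [AddCommGroup B] (e : A ≃+ B) :
   (nsmulAddMonoidHom 2 : A →+ A).range.index = (nsmulAddMonoidHom 2 : B →+ B).range.index := by
  rw [← AddSubgroup.index_map_equiv _ e]
  congr 1
  ext b
  simp only [AddSubgroup.mem_map, AddMonoidHom.mem_range, nsmulAddMonoidHom_apply]
  constructor
  · rintro ⟨_, ⟨a, rfl⟩, rfl⟩
    exact ⟨e a, by simp⟩
  · rintro ⟨a, rfl⟩
    exact ⟨_, ⟨e.symm a, rfl⟩, by simp⟩

theorem ker_equiv {A B : Type*} [AddCommGroup A] [AddCommGroup B] (e : A ≃+ B) :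
   Nat.card (nsmulAddMonoidHom 2 : A →+ A).ker = Nat.card (nsmulAddMonoidHom 2 : B →+ B).ker := by
  refine Nat.card_congr (e.toEquiv.subtypeEquiv ?_)
  intro a
  simp [AddMonoidHom.mem_ker, ← map_nsmul]

theorem ker_prod {A B : Type*} [AddCommGroup A] [AddCommGroup B]  :
   Nat.card (nsmulAddMonoidHom 2 : A × B →+ A × B).ker = 
    Nat.card (nsmulAddMonoidHom 2 : A →+ A).ker * Nat.card (nsmulAddMonoidHom 2 : B →+ B).ker := by
  have : (nsmulAddMonoidHom 2 : A × B →+ A × B).ker = 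
    (nsmulAddMonoidHom 2 : A →+ A).ker.prod (nsmulAddMonoidHom 2 : B →+ B).ker := by
    ext ⟨a, b⟩
    simp [AddSubgroup.mem_prod, AddMonoidHom.mem_ker]
  rw [this, ← Nat.card_prod]
  exact Nat.card_congr (AddSubgroup.prodEquiv _ _).toEquiv

theorem idx_fin (A : Type*) [AddCommGroup A] [Finite A] :
    (nsmulAddMonoidHom 2 : A →+ A).range.index = Nat.card (nsmulAddMonoidHom 2 : A →+ A).ker := by
  have h1 := (nsmulAddMonoidHom 2 : A →+ A).range.index_mul_card
  have h2 := (nsmulAddMonoidHom 2 : A →+ A).ker.index_mul_card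
  rw [AddSubgroup.index_ker] at h2
  have h3 : 0 < Nat.card (nsmulAddMonoidHom 2 : A →+ A).range := Nat.card_pos
  have : Nat.card A = _ := rfl
  nlinarith

theorem idx_free (n : ℕ) : 
    (nsmulAddMonoidHom 2 : (Fin n → ℤ) →+ (Fin n → ℤ)).range.index = 2 ^ n := by
  induction n with
  | zero => 
    rw [pow_zero, AddSubgroup.index_eq_one]
    exact Subsingleton.elim _ _
  | succ n ih => 
    rw [idx_equiv (AddEquiv.mk' (Fin.consEquiv (fun _ : Fin (n+1) => ℤ)).symm (by intro x y; rfl)), idx_prod, AddSubgroup.index_prod, ih, pow_succ, mul_comm]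
    congr 1
    have : (nsmulAddMonoidHom 2 : ℤ →+ ℤ).range = AddSubgroup.zmultiples 2 := by
      ext x
      simp [AddSubgroup.mem_zmultiples_iff, mul_comm]
    rw [this, Int.index_zmultiples]
    rfl

theorem idx_ker_free (n : ℕ) : 
    Nat.card (nsmulAddMonoidHom 2 : (Fin n → ℤ) →+ (Fin n → ℤ)).ker = 1 := by
  have : (nsmulAddMonoidHom 2 : (Fin n → ℤ) →+ (Fin n → ℤ)).ker = ⊥ := by
    ext x
    simp only [AddMonoidHom.mem_ker, nsmulAddMonoidHom_apply, AddSubgroup.mem_bot, funext_iff]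
    simp
  rw [this]; simp

theorem fr_rank_nullity {R A B : Type*} [CommRing R] [IsDomain R] [AddCommGroup A]
    [AddCommGroup B] [Module R A] [Module R B]
    [Module.Finite R A] (f : A →ₗ[R] B) :
    Module.finrank R (LinearMap.range f) + Module.finrank R (LinearMap.ker f) = Module.finrank R A := by
  rw [← f.quotKerEquivRange.finrank_eq]
  exact Submodule.finrank_quotient_add_finrank _

theorem idx_aux {A T : Type*} [AddCommGroup A] [AddCommGroup T] [Finite T] (n : ℕ)
    (f : A ≃+ (Fin n →₀ ℤ) × T) :
    (nsmulAddMonoidHom 2 : A →+ A).range.index =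
      2 ^ Module.finrank ℤ A * Nat.card (nsmulAddMonoidHom 2 : A →+ A).ker := by
  let g : ((Fin n →₀ ℤ) × T) ≃+ ((Fin n → ℤ) × T) := 
    AddEquiv.prodCongr (Finsupp.linearEquivFunOnFinite ℤ ℤ (Fin n)).toAddEquiv (AddEquiv.refl _)
  have f' := f.trans g
  rw [idx_equiv f', ker_equiv f', idx_prod, ker_prod, AddSubgroup.index_prod, idx_free, idx_ker_free, 
    idx_fin, one_mul, f'.toIntLinearEquiv.finrank_eq]
  congr 2
  have h := fr_rank_nullity (LinearMap.fst ℤ (Fin n → ℤ) T)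
  rw [LinearMap.range_eq_top.2 LinearMap.fst_surjective, finrank_top, Module.finrank_fin_fun] at h
  have h0 : Module.finrank ℤ (LinearMap.ker (LinearMap.fst ℤ (Fin n → ℤ) T)) = 0 := by
    rw [Module.finrank_eq_zero_iff_isTorsion]
    rintro ⟨⟨x, t⟩, hx⟩
    refine ⟨⟨(Nat.card T : ℤ), mem_nonZeroDivisors_of_ne_zero (by exact_mod_cast Nat.card_pos.ne')⟩, ?_⟩
    simp only [LinearMap.mem_ker, LinearMap.fst_apply] at hx
    subst hx
    ext1
    simp [Prod.ext_iff, Submonoid.smul_def]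
  omega

theorem idx_main (A : Type*) [AddCommGroup A] [Module.Finite ℤ A] :
    (nsmulAddMonoidHom 2 : A →+ A).range.index =
      2 ^ Module.finrank ℤ A * Nat.card (nsmulAddMonoidHom 2 : A →+ A).ker := by
  have : AddGroup.FG A := Module.Finite.iff_addGroup_fg.mp inferInstance
  obtain ⟨n, ι, fι, p, hp, e, ⟨f⟩⟩ := AddCommGroup.equiv_free_prod_directSum_zmod A
  have : ∀ i, NeZero (p i ^ e i) := fun i => ⟨pow_ne_zero _ (hp i).ne_zero⟩
  have : Finite (DirectSum ι fun i => ZMod (p i ^ e i)) := 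
    Finite.of_equiv _ (DirectSum.addEquivProd _).symm.toEquiv
  exact idx_aux n f

theorem idx_mul (G : Type*) [CommGroup G] [Module.Finite ℤ (Additive G)] :
    (powMonoidHom 2 : G →* G).range.index =
      2 ^ Module.finrank ℤ (Additive G) * Nat.card (powMonoidHom 2 : G →* G).ker :=
  idx_main (Additive G)

/-- Abstract Herbrand-type computation. -/
theorem abstract_main {E F : Type*} [CommGroup E] [CommGroup F]
    [Module.Finite ℤ (Additive E)] [Module.Finite ℤ (Additive F)]
    (N : E →* F) (ι : F →* E) (s : E →* E) (hι : Function.Injective ι)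
    (hN : ∀ x, ι (N x) = x * s x) (hsι : ∀ y, s (ι y) = ι y)
    (hfix : ∀ x, s x = x → ∃ y, ι y = x)
    (hrank : Module.finrank ℤ (Additive E) = 2 * Module.finrank ℤ (Additive F) + 1)
    (hF : Nat.card (powMonoidHom 2 : F →* F).ker = 2)
    (hA : Nat.card (powMonoidHom 2 : N.ker →* N.ker).ker = 2)
    (D : E →* N.ker) (hD : ∀ x, (D x : E) = x / s x)
    (hidx : D.range.index ≤ 2) : N.range = ⊤ := by
  have hNι : ∀ y, N (ι y) = y ^ 2 := fun y => hι (by rw [hN, hsι, map_pow, sq])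
  have hDA : ∀ a : N.ker, D a = a ^ 2 := by
    rintro ⟨a, ha⟩
    ext1
    have h1 := hN a
    rw [MonoidHom.mem_ker.1 ha, map_one] at h1
    have h2 : s a = a⁻¹ := (inv_eq_of_mul_eq_one_right h1.symm).symm
    simp [hD, h2, sq]
  have hDker : D.ker = ι.range := by
    ext x
    rw [MonoidHom.mem_ker, MonoidHom.mem_range, Subtype.ext_iff, hD]
    constructor
    · intro h
      exact hfix x (div_eq_one.1 h).symm
    · rintro ⟨y, rfl⟩
      simp [hsι]
  have m1 : ι.range.map N = (powMonoidHom 2 : F →* F).range := by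
    ext y
    simp [Subgroup.mem_map, hNι]
  have m2 : N.ker.map D = (powMonoidHom 2 : N.ker →* N.ker).range := by
    ext y
    simp only [Subgroup.mem_map, MonoidHom.mem_range, powMonoidHom_apply]
    constructor
    · rintro ⟨x, hx, rfl⟩
      exact ⟨⟨x, hx⟩, (hDA ⟨x, hx⟩).symm⟩
    · rintro ⟨x, rfl⟩
      exact ⟨x, x.2, hDA x⟩
  have i1 := Subgroup.index_map ι.range N
  have i2 := Subgroup.index_map N.ker D
  have fA : Module.Finite ℤ (Additive N.ker) := 
    inferInstanceAs (Module.Finite ℤ (LinearMap.ker N.toAdditive.toIntLinearMap))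
  rw [m1, idx_mul, hF] at i1
  rw [m2, idx_mul, hA, hDker, sup_comm] at i2
  have r1 : Module.finrank ℤ (LinearMap.range N.toAdditive.toIntLinearMap) + Module.finrank ℤ (Additive N.ker) 
      = Module.finrank ℤ (Additive E) := fr_rank_nullity N.toAdditive.toIntLinearMap
  have r2 : Module.finrank ℤ (LinearMap.range N.toAdditive.toIntLinearMap) = Module.finrank ℤ (Additive F) := by
    have h := Submodule.finrank_quotient_add_finrank (LinearMap.range N.toAdditive.toIntLinearMap)
    have h0 : Module.finrank ℤ (Additive F ⧸ LinearMap.range N.toAdditive.toIntLinearMap) = 0 := by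
      rw [Module.finrank_eq_zero_iff_isTorsion]
      intro x
      obtain ⟨y, rfl⟩ := Submodule.Quotient.mk_surjective _ x
      refine ⟨⟨2, by simp⟩, ?_⟩
      rw [Submonoid.smul_def, ← Submodule.Quotient.mk_smul, Submodule.Quotient.mk_eq_zero]
      refine ⟨Additive.ofMul (ι y.toMul), ?_⟩
      change Additive.ofMul (N (ι y.toMul)) = (2 : ℤ) • y
      rw [hNι]
      exact (ofNat_zsmul y 2).symm
    omega
  have r3 : Module.finrank ℤ (Additive N.ker) = Module.finrank ℤ (Additive F) + 1 := by omega
  rw [r3, pow_succ] at i2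
  rw [← Subgroup.index_eq_one]
  have hp : 0 < 2 ^ Module.finrank ℤ (Additive F) := by positivity
  set m := (ι.range ⊔ N.ker).index
  have hm : 0 < m := by
    rcases Nat.eq_zero_or_pos m with h | h
    · rw [h] at i1; omega
    · exact h
  have : m * D.range.index = m * (2 * N.range.index) := by
    rw [← i2, mul_left_comm, ← i1]; ring
  have := Nat.eq_of_mul_eq_mul_left hm this
  have : N.range.index ≠ 0 := by
    intro h
    rw [h] at i1; omega
  omega

theorem quad_facts (k K : Type*) [Field k] [NumberField k] [Field K] [NumberField K]
    [Algebra k K] [IsGalois k K] (hdeg : Module.finrank k K = 2) :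
    ∃ σ : Gal(K/k), (∀ g : Gal(K/k), g = 1 ∨ g = σ) ∧
      (∀ x : 𝓞 K, algebraMap (𝓞 k) (𝓞 K) (RingOfIntegers.norm k x) =
        x * galRestrict (𝓞 k) k K (𝓞 K) σ x) ∧
      (∀ x : 𝓞 K, galRestrict (𝓞 k) k K (𝓞 K) σ x = x → ∃ y, algebraMap (𝓞 k) (𝓞 K) y = x) ∧
      (∃ x : 𝓞 K, galRestrict (𝓞 k) k K (𝓞 K) σ x ≠ x) ∧
      (∀ x, galRestrict (𝓞 k) k K (𝓞 K) σ (galRestrict (𝓞 k) k K (𝓞 K) σ x) = x) := by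
  have hc : Nat.card Gal(K/k) = 2 := by rw [IsGalois.card_aut_eq_finrank, hdeg]
  obtain ⟨σ, hσ1, hu⟩ : ∃ σ : Gal(K/k), σ ≠ 1 ∧ ∀ g, g = 1 ∨ g = σ := by
    obtain ⟨σ, hσ, hσ'⟩ := (Nat.card_eq_two_iff' (1 : Gal(K/k))).1 hc
    refine ⟨σ, hσ, fun g => ?_⟩
    by_cases h : g = 1
    · exact Or.inl h
    · exact Or.inr (hσ' g h)
  have huniv : (Finset.univ : Finset Gal(K/k)) = {1, σ} := by
    ext g; simpa using hu g
  have inj : Function.Injective (algebraMap (𝓞 K) K) := FaithfulSMul.algebraMap_injective _ _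
  have hr : ∀ x : 𝓞 K, algebraMap (𝓞 K) K (galRestrict (𝓞 k) k K (𝓞 K) σ x) =
    σ (algebraMap (𝓞 K) K x) := fun x => algebraMap_galRestrict_apply _ _ _
  have hss : σ * σ = 1 := by
    rcases hu (σ * σ) with h | h
    · exact h
    · exact absurd (mul_eq_left.1 h) hσ1
  have hfix : ∀ x : 𝓞 K, galRestrict (𝓞 k) k K (𝓞 K) σ x = x →
      ∃ y, algebraMap (𝓞 k) (𝓞 K) y = x := by
    intro x hx
    have : (algebraMap (𝓞 K) K x) ∈ Set.range (algebraMap k K) := by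
      rw [IsGalois.mem_range_algebraMap_iff_fixed]
      intro f
      rcases hu f with rfl | rfl
      · rfl
      · rw [← hr, hx]
    obtain ⟨y, hy⟩ := this
    have hyi : IsIntegral ℤ y := by
      rw [← isIntegral_algebraMap_iff (algebraMap k K).injective, hy]
      exact x.2
    refine ⟨⟨y, hyi⟩, inj ?_⟩
    rw [← hy]
    rfl
  refine ⟨σ, hu, ?_, hfix, ?_, ?_⟩
  · intro x
    apply inj
    rw [map_mul, hr]
    have h := Algebra.norm_eq_prod_automorphisms k (algebraMap (𝓞 K) K x)
    rw [huniv, Finset.prod_pair hσ1.symm] at h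
    rw [AlgEquiv.one_apply] at h
    rw [← h]
    rfl
  · by_contra! hall
    apply hσ1
    have : galRestrict (𝓞 k) k K (𝓞 K) σ = 1 := by
      ext1 x; exact hall x
    exact (galRestrict (𝓞 k) k K (𝓞 K)).injective (by rw [this, map_one])
  · intro x
    rw [← AlgEquiv.mul_apply, ← map_mul, hss, map_one, AlgEquiv.one_apply]

theorem hilbert90_quad {R : Type*} [CommRing R] [IsDomain R] (τ : R →+* R)
    (hne : ∃ x, τ x ≠ x) (hss : ∀ x, τ (τ x) = x) (a : R) (ha : a * τ a = 1) :
    ∃ x, x ≠ 0 ∧ a * τ x = x := by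
  by_cases h : 1 + a = 0
  · obtain ⟨y, hy⟩ := hne
    refine ⟨y - τ y, fun h0 => hy (sub_eq_zero.1 h0).symm, ?_⟩
    have : a = -1 := by linear_combination h
    rw [this, map_sub, hss]; ring
  · exact ⟨1 + a, h, by rw [map_add, map_one, mul_add, ha]; ring⟩

/-- The class attached to a unit of relative norm one. -/
theorem exists_class (k K : Type*) [Field k] [NumberField k] [Field K] [NumberField K]
    [Algebra k K] [IsGalois k K]
    (hram : ∀ 𝔮 : Ideal (𝓞 k), 𝔮.IsPrime → 𝔮 ≠ ⊥ → ¬ ∃ 𝔓 : Ideal (𝓞 K), 𝔓.IsPrime ∧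
       𝔓 ^ 2 ∣ Ideal.map (algebraMap (𝓞 k) (𝓞 K)) 𝔮) (τ : 𝓞 K →+* 𝓞 K) (σ : Gal(K/k))
    (hτ : ∀ x, τ x = galRestrict (𝓞 k) k K (𝓞 K) σ x)
    (hu : ∀ g : Gal(K/k), g = 1 ∨ g = σ)
    (hN : ∀ x : 𝓞 K, algebraMap (𝓞 k) (𝓞 K) (RingOfIntegers.norm k x) = x * τ x)
    (hne : ∃ x, τ x ≠ x) (hss : ∀ x, τ (τ x) = x) (a : (𝓞 K)ˣ) (ha : (a : 𝓞 K) * τ a = 1) :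
    ∃ (x : 𝓞 K) (I : nonZeroDivisors (Ideal (𝓞 k))), x ≠ 0 ∧ a * τ x = x ∧
      (I : Ideal (𝓞 k)).map (algebraMap (𝓞 k) (𝓞 K)) = Ideal.span {x} ∧
      ClassGroup.mk0 I ^ 2 = 1 := by
  obtain ⟨x, hx0, hx⟩ := hilbert90_quad τ hne hss a ha
  have hx' : τ x = (a⁻¹ : (𝓞 K)ˣ) * x := by
    rw [eq_comm, Units.inv_mul_eq_iff_eq_mul, hx]
  obtain ⟨I, hI⟩ := invariant_ideal k K hram (Ideal.span {x}) (by simpa using hx0) (by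
    intro g
    rw [Ideal.map_span, Set.image_singleton, Ideal.span_singleton_le_span_singleton]
    rcases hu g with rfl | rfl
    · simp
    · change x ∣ galRestrict (𝓞 k) k K (𝓞 K) g x
      rw [← hτ, hx']
      exact Dvd.intro_left _ rfl)
  have hI0 : I ≠ 0 := by
    rintro rfl
    apply hx0
    rw [← Ideal.span_singleton_eq_bot, ← hI]
    exact Ideal.map_bot
  refine ⟨x, ⟨I, mem_nonZeroDivisors_of_ne_zero hI0⟩, hx0, hx, hI, ?_⟩
  have hsq : I ^ 2 = Ideal.span {RingOfIntegers.norm k x} := by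
    apply FractionalIdeal.coeIdeal_injective (K := k)
    apply FractionalIdeal.extendedHom_injective (𝓞 k) k K (𝓞 K)
    simp only [FractionalIdeal.extendedHom_coeIdeal_eq_map]
    congr 1
    rw [Ideal.map_pow, hI, Ideal.map_span, Set.image_singleton, hN, Ideal.span_singleton_pow, hx',
      Ideal.span_singleton_eq_span_singleton]
    exact ⟨a⁻¹, by ring⟩
  rw [← map_pow]
  have h2 : I ^ 2 ∈ nonZeroDivisors (Ideal (𝓞 k)) :=
    mem_nonZeroDivisors_of_ne_zero (pow_ne_zero _ hI0)
  change ClassGroup.mk0 ⟨I ^ 2, h2⟩ = 1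
  rw [ClassGroup.mk0_eq_one_iff h2, hsq]
  exact ⟨⟨_, rfl⟩⟩


theorem units_sq (L : Type*) [Field L] [NumberField L] (x : (𝓞 L)ˣ) :
    x ^ 2 = 1 ↔ x = 1 ∨ x = -1 := by
  rw [Units.ext_iff, Units.ext_iff, Units.ext_iff]
  simp

theorem units_neg_one_ne (L : Type*) [Field L] [NumberField L] : (-1 : (𝓞 L)ˣ) ≠ 1 := by
  intro h
  have h1 : (-1 : 𝓞 L) = 1 := congrArg Units.val h
  have h2 : (2 : 𝓞 L) = 0 := by linear_combination -h1
  exact two_ne_zero h2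

/-- If the 2-class group of `k` is cyclic and `K/k` is a quadratic extension unramified
at all finite and infinite places, then `E_k = N_{K/k} E_K`. -/
theorem units_are_norms_of_unramified_quadratic
    (k : Type*) [Field k] [NumberField k]
    (hcyc : ∀ P : Sylow 2 (ClassGroup (𝓞 k)), IsCyclic (P : Subgroup (ClassGroup (𝓞 k))))
    (K : Type*) [Field K] [NumberField K] [Algebra k K]
    (hdeg : Module.finrank k K = 2)
    (hram : ∀ 𝔮 : Ideal (𝓞 k), 𝔮.IsPrime → 𝔮 ≠ ⊥ → ¬ IsRamifiedIn k K 𝔮)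
    (hinf : UnramifiedAtInfinitePlaces k K)
    : relUnitNormRange k K = ⊤ := by
  have hq : Algebra.IsQuadraticExtension k K := ⟨hdeg⟩
  have hgal : IsGalois k K := inferInstance
  have hui : IsUnramifiedAtInfinitePlaces k K := unram_inf k K hinf
  obtain ⟨σ, hu, hN, hfix, hne, hss⟩ := quad_facts k K hdeg
  obtain ⟨τ, hτ⟩ : ∃ τ : 𝓞 K →+* 𝓞 K, ∀ x, τ x = galRestrict (𝓞 k) k K (𝓞 K) σ x :=
    ⟨(galRestrict (𝓞 k) k K (𝓞 K) σ : 𝓞 K →+* 𝓞 K), fun _ => rfl⟩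
  have hτalg : ∀ y, τ (algebraMap (𝓞 k) (𝓞 K) y) = algebraMap (𝓞 k) (𝓞 K) y := fun y => by
    rw [hτ]; exact (galRestrict (𝓞 k) k K (𝓞 K) σ).commutes y
  simp only [← hτ] at hN hfix hne hss
  have hinj : Function.Injective (algebraMap (𝓞 k) (𝓞 K)) := FaithfulSMul.algebraMap_injective _ _
  let N : (𝓞 K)ˣ →* (𝓞 k)ˣ := Units.map (RingOfIntegers.norm k : 𝓞 K →* 𝓞 k)
  let ι : (𝓞 k)ˣ →* (𝓞 K)ˣ := Units.map (algebraMap (𝓞 k) (𝓞 K) : 𝓞 k →* 𝓞 K)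
  let s : (𝓞 K)ˣ →* (𝓞 K)ˣ := Units.map (τ : 𝓞 K →* 𝓞 K)
  have hι : Function.Injective ι := Units.map_injective hinj
  have hNu : ∀ x, ι (N x) = x * s x := fun x => Units.ext (hN x)
  have hssu : ∀ x, s (s x) = x := fun x => Units.ext (hss x)
  have hsι : ∀ y, s (ι y) = ι y := fun y => Units.ext (hτalg y)
  have hNs : ∀ x, N (x / s x) = 1 := fun x => hι (by
    rw [hNu, map_div, hssu, map_one]; simp)
  have hkerN : ∀ a : N.ker, ((a : (𝓞 K)ˣ) : 𝓞 K) * τ (a : (𝓞 K)ˣ) = 1 := by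
    rintro ⟨a, ha⟩
    have h := hNu a
    rw [MonoidHom.mem_ker.1 ha, map_one] at h
    exact (congrArg Units.val h).symm
  let D : (𝓞 K)ˣ →* N.ker :=
    (MonoidHom.id (𝓞 K)ˣ / s).codRestrict N.ker (fun x => MonoidHom.mem_ker.2 (hNs x))
  have hD : ∀ x, (D x : (𝓞 K)ˣ) = x / s x := fun x => rfl
  have hF : Nat.card (powMonoidHom 2 : (𝓞 k)ˣ →* (𝓞 k)ˣ).ker = 2 :=
    card_ker_two (-1) (units_neg_one_ne k) (units_sq k)
  have hA : Nat.card (powMonoidHom 2 : N.ker →* N.ker).ker = 2 := by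
    have hm : (-1 : (𝓞 K)ˣ) ∈ N.ker := by
      rw [MonoidHom.mem_ker]
      apply hι
      rw [hNu, map_one]
      ext1
      simp [s]
    refine card_ker_two ⟨-1, hm⟩ ?_ ?_
    · intro h
      exact units_neg_one_ne K (congrArg Subtype.val h)
    · rintro ⟨x, hx⟩
      simpa [Subtype.ext_iff] using units_sq K x
  have hrank : Module.finrank ℤ (Additive (𝓞 K)ˣ) =
      2 * Module.finrank ℤ (Additive (𝓞 k)ˣ) + 1 := by
    rw [Units.finrank_eq, Units.finrank_eq]
    unfold Units.rank
    have h := IsUnramifiedAtInfinitePlaces.card_infinitePlace k K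
    rw [hdeg] at h
    have h1 : 0 < Fintype.card (InfinitePlace k) := Fintype.card_pos
    omega
  have hfixu : ∀ x, s x = x → ∃ y, ι y = x := by
    intro x hx
    obtain ⟨y, hy⟩ := hfix x (congrArg Units.val hx)
    have hx' : s x⁻¹ = x⁻¹ := by rw [map_inv, hx]
    obtain ⟨z, hz⟩ := hfix (x⁻¹ : (𝓞 K)ˣ) (congrArg Units.val hx')
    have hyz : y * z = 1 := hinj (by rw [map_mul, hy, hz, map_one]; simp)
    exact ⟨⟨y, z, hyz, by rw [mul_comm, hyz]⟩, Units.ext hy⟩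
  refine abstract_main N ι s hι hNu hsι hfixu hrank hF hA D hD ?_
  have hcl := fun a : N.ker =>
    exists_class k K hram τ σ hτ hu hN hne hss (a : (𝓞 K)ˣ) (hkerN a)
  choose X I hX0 hX hI hI2 using hcl
  refine le_trans ?_ (two_torsion_le hcyc)
  let f : N.ker ⧸ D.range → {c : ClassGroup (𝓞 k) // c ^ 2 = 1} :=
    fun q => ⟨ClassGroup.mk0 (I q.out), hI2 q.out⟩
  refine Nat.card_le_card_of_injective f ?_
  intro q q' hqq
  rw [← Quotient.out_eq q, ← Quotient.out_eq q']
  have h := congrArg Subtype.val hqq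
  change ClassGroup.mk0 (I q.out) = ClassGroup.mk0 (I q'.out) at h
  generalize q.out = a at *
  generalize q'.out = b at *
  apply QuotientGroup.eq.2
  rw [ClassGroup.mk0_eq_mk0_iff] at h
  obtain ⟨c, d, hc, hd, hcd⟩ := h
  have h2 := congrArg (Ideal.map (algebraMap (𝓞 k) (𝓞 K))) hcd
  rw [Ideal.map_mul, Ideal.map_mul, hI, hI, Ideal.map_span, Ideal.map_span, Set.image_singleton,
    Set.image_singleton, Ideal.span_singleton_mul_span_singleton,
    Ideal.span_singleton_mul_span_singleton, Ideal.span_singleton_eq_span_singleton] at h2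
  obtain ⟨e, he⟩ := h2
  -- `c X_a e = d X_b`
  have h3 := congrArg τ he
  simp only [map_mul, hτalg] at h3
  have hXa := hX a
  have hXb := hX b
  have hc' : algebraMap (𝓞 k) (𝓞 K) c ≠ 0 := by rwa [Ne, map_eq_zero_iff _ hinj]
  have hτ0 : τ (X a) ≠ 0 := by
    intro h0
    rw [h0, mul_zero] at hXa
    exact hX0 a hXa.symm
  have key : ((a : (𝓞 K)ˣ) : 𝓞 K) * e = (b : (𝓞 K)ˣ) * τ e := by
    apply mul_left_cancel₀ (mul_ne_zero hc' hτ0)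
    rw [← hXa, ← hXb] at he
    linear_combination he - ((b : (𝓞 K)ˣ) : 𝓞 K) * h3
  refine ⟨e, ?_⟩
  ext1
  rw [hD]
  have key' : (a : (𝓞 K)ˣ) * e = (b : (𝓞 K)ˣ) * s e := Units.ext key
  simp only [Subgroup.coe_mul, Subgroup.coe_inv]
  rw [div_eq_iff_eq_mul, mul_assoc, eq_inv_mul_iff_mul_eq, key']
end

section
/- Let F be a number field with odd class number h(F), let 𝔭₁ and 𝔭₂ be primary prime ideals of odd norm, write 𝔭₁^{h(F)} = (π₁) with π₁ primary, set k₁ = F(√π₁) with unit group E₁, and let 𝔓₂ be a prime ideal of k₁ above 𝔭₂. Then for units η, η' ∈ E₁ with equal relative norms N_{k₁/F}(η) = N_{k₁/F}(η'), one has [η/𝔓₂] = [η'/𝔓₂]; equivalently, [η/𝔓₂] = +1 for every unit η ∈ E₁ with N_{k₁/F}(η) = 1. -/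
open NumberField
open scoped Classical

/-- The quadratic residue symbol `[α/𝔭] ∈ {±1}`, determined by Euler's congruence
`[α/𝔭] ≡ α^((N𝔭 - 1)/2) (mod 𝔭)`. -/
noncomputable def quadResSym (F : Type*) [Field F] [NumberField F]
    (𝔭 : Ideal (𝓞 F)) (α : 𝓞 F) : ℤ :=
  if α ^ ((Ideal.absNorm 𝔭 - 1) / 2) - 1 ∈ 𝔭 then 1 else -1

/-- An ideal `𝔭` is primary if `[ε/𝔭] = 1` for every unit `ε`, i.e. `(E_F/𝔭) = +1`. -/
def IsPrimaryIdeal (F : Type*) [Field F] [NumberField F] (𝔭 : Ideal (𝓞 F)) : Prop :=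
  ∀ ε : (𝓞 F)ˣ, quadResSym F 𝔭 (ε : 𝓞 F) = 1

/-- An element of the ring of integers is primary if it is totally positive and
congruent to a square modulo 4. -/
def IsPrimaryElem (F : Type*) [Field F] [NumberField F] (α : 𝓞 F) : Prop :=
  (∀ φ : F →+* ℝ, 0 < φ (algebraMap (𝓞 F) F α)) ∧ ∃ ξ : 𝓞 F, (4 : 𝓞 F) ∣ α - ξ ^ 2


lemma aux_sq_factor {R : Type*} [CommRing R] [IsDedekindDomain R] (I p : Ideal R) (hI : I ≠ ⊥)
    (h : ∀ q : Ideal R, q.IsPrime → q ≠ ⊥ → q ≠ p → ∃ n : ℕ, emultiplicity q I = 2 * n) :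
    ∃ (J : Ideal R) (n : ℕ), I = J ^ 2 * p ^ n := by
  set s := UniqueFactorizationMonoid.normalizedFactors I with hs
  have hprod : s.prod = I := Ideal.prod_normalizedFactors_eq_self hI
  have h2 : ∃ u : Multiset (Ideal R), s.filter (fun x => ¬ x = p) = 2 • u := by
    apply Multiset.exists_smul_of_dvd_count
    intro a ha
    rw [Multiset.mem_filter] at ha
    rw [Multiset.count_filter_of_pos (p := fun x => ¬ x = p) ha.2]
    have hap := UniqueFactorizationMonoid.prime_of_normalized_factor a ha.1
    obtain ⟨n, hn⟩ := h a (Ideal.isPrime_of_prime hap) hap.ne_zero ha.2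
    rw [UniqueFactorizationMonoid.emultiplicity_eq_count_normalizedFactors hap.irreducible hI,
      normalize_eq] at hn
    exact ⟨n, by exact_mod_cast hn⟩
  obtain ⟨u, hu⟩ := h2
  have h3 : s.filter (fun x => x = p) = Multiset.replicate (s.count p) p := by
    simp [Multiset.filter_eq']
  refine ⟨u.prod, s.count p, ?_⟩
  rw [← hprod]
  conv_lhs => rw [← Multiset.filter_add_not (p := fun x => x = p) s]
  rw [Multiset.prod_add, hu, h3, Multiset.prod_replicate, Multiset.prod_nsmul, mul_comm]

lemma aux_pi_not_sq {R : Type*} [CommRing R] [IsDedekindDomain R] (p : Ideal R) (hp : p.IsPrime)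
    (hp0 : p ≠ ⊥) (h : ℕ) (hodd : Odd h) (π b : R) (hg : p ^ h = Ideal.span {π})
    (hb : b ^ 2 = π) : False := by
  have hpp : Prime p := Ideal.prime_of_isPrime hp0 hp
  rw [← hb, ← Ideal.span_singleton_pow] at hg
  have hb0 : Ideal.span {b} ≠ ⊥ := by
    intro h0
    rw [h0] at hg
    exact hp0 (pow_eq_zero_iff hodd.pos.ne' |>.1 (hg.trans (by simp)))
  have h1 := congrArg (emultiplicity p) hg
  rw [emultiplicity_pow hpp, emultiplicity_pow hpp,
    UniqueFactorizationMonoid.emultiplicity_eq_count_normalizedFactors hpp.irreducible hb0,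
    (FiniteMultiplicity.of_prime_left hpp hp0).emultiplicity_self] at h1
  norm_cast at h1
  rw [mul_one] at h1
  rw [h1] at hodd
  exact (Nat.not_odd_iff_even.2 (even_two_mul _)) hodd

lemma aux_trace (F : Type*) [Field F] [NumberField F] (k : Type*) [Field k] [NumberField k]
    [Algebra F k] (hdeg : Module.finrank F k = 2) (η : 𝓞 k)
    (hη : RingOfIntegers.norm F η = 1) :
    ∃ s : 𝓞 F, η * algebraMap (𝓞 F) (𝓞 k) s = (1 + η) ^ 2 := by
  have hn : Algebra.norm F (η : k) = 1 := by
    rw [← RingOfIntegers.coe_norm, hη]; simp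
  have key : (η : k) ^ 2 - algebraMap F k (Algebra.trace F k (η : k)) * η + 1 = 0 := by
    let b := Module.finBasisOfFinrankEq F k hdeg
    apply Algebra.leftMulMatrix_injective b
    have h := Matrix.aeval_self_charpoly (Algebra.leftMulMatrix b (η : k))
    rw [Matrix.charpoly_fin_two, ← Algebra.norm_eq_matrix_det, ← Algebra.trace_eq_matrix_trace,
      hn] at h
    simp only [map_sub, map_add, map_mul, map_pow, Polynomial.aeval_X, Polynomial.aeval_C,
      map_one, AlgHom.commutes, map_zero] at h ⊢
    exact h
  have hti : IsIntegral ℤ (Algebra.trace F k (η : k)) :=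
    Algebra.isIntegral_trace (RingOfIntegers.isIntegral_coe η)
  let t : 𝓞 F := ⟨Algebra.trace F k (η : k), hti⟩
  refine ⟨t + 1 + 1, ?_⟩
  apply RingOfIntegers.ext
  simp only [map_add, map_mul, map_pow, map_one]
  have : algebraMap (𝓞 k) k (algebraMap (𝓞 F) (𝓞 k) t) =
    algebraMap F k (Algebra.trace F k (η : k)) := rfl
  rw [this]
  linear_combination -key

lemma aux_unram (F : Type*) [Field F] [NumberField F] (k : Type*) [Field k] [NumberField k]
    [Algebra F k] (hdeg : Module.finrank F k = 2)
    (p : Ideal (𝓞 F)) (hp : p.IsPrime) (hp0 : p ≠ ⊥) (h : ℕ) (hodd : Odd h) (π ξ c : 𝓞 F)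
    (hg : p ^ h = Ideal.span {π}) (hc : π - ξ ^ 2 = 4 * c)
    (β : k) (hβ : β ^ 2 = algebraMap F k (algebraMap (𝓞 F) F π))
    (q : Ideal (𝓞 F)) (hq : q.IsPrime) (hq0 : q ≠ ⊥) (hqp : q ≠ p) (P : Ideal (𝓞 k))
    (hP : P.IsPrime) (hPq : P.LiesOver q) : ¬ q.map (algebraMap (𝓞 F) (𝓞 k)) ≤ P ^ 2 := by
  intro hle
  set x : F := algebraMap (𝓞 F) F ξ with hx
  set y : F := algebraMap (𝓞 F) F c with hy
  have hc' : algebraMap (𝓞 F) F π = x ^ 2 + 4 * y := by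
    have h4 : algebraMap (𝓞 F) F 4 = 4 := map_ofNat _ 4
    rw [hx, hy, sub_eq_iff_eq_add.1 hc, map_add, map_mul, map_pow, h4, add_comm]
  rw [hc'] at hβ
  simp only [map_add, map_mul, map_pow, map_ofNat] at hβ
  set w : k := (β + algebraMap F k x) / 2 with hw
  have hw2 : w ^ 2 - algebraMap F k x * w - algebraMap F k y = 0 := by
    rw [hw]; linear_combination hβ / 4
  let f : Polynomial (𝓞 F) := Polynomial.X ^ 2 - Polynomial.C ξ * Polynomial.X - Polynomial.C c
  have hfm : f.Monic := by simp only [f]; monicity!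
  have hfd : f.natDegree = 2 := by simp only [f]; compute_degree!
  have hwint' : IsIntegral (𝓞 F) w := by
    refine ⟨f, hfm, ?_⟩
    simp only [f, Polynomial.eval₂_sub, Polynomial.eval₂_mul, Polynomial.eval₂_pow,
      Polynomial.eval₂_X, Polynomial.eval₂_C]
    exact hw2
  have hwint : IsIntegral ℤ w := isIntegral_trans (R := ℤ) (A := 𝓞 F) w hwint'
  let ω : 𝓞 k := ⟨w, hwint⟩
  have hωw : algebraMap (𝓞 k) k ω = w := rfl
  have hωint : IsIntegral (𝓞 F) ω := Algebra.IsIntegral.isIntegral ω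
  have hfω : Polynomial.aeval ω f = 0 := by
    apply RingOfIntegers.ext
    simp only [f, map_sub, map_mul, map_pow, Polynomial.aeval_X, Polynomial.aeval_C, map_zero]
    exact hw2
  have hint : IntermediateField.adjoin F {w} = ⊤ := by
    have := IntermediateField.isSimpleOrder_of_finrank_prime F k (by rw [hdeg]; exact Nat.prime_two)
    rcases eq_bot_or_eq_top (IntermediateField.adjoin F {w}) with h0 | h0
    · exfalso
      rw [IntermediateField.adjoin_simple_eq_bot_iff, IntermediateField.mem_bot] at h0
      obtain ⟨z, hz⟩ := h0
      have hz2 : (2 * z - x) ^ 2 = algebraMap (𝓞 F) F π := by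
        apply (algebraMap F k).injective
        rw [hc']
        simp only [map_sub, map_mul, map_pow, map_add, map_ofNat, hz]
        rw [← hβ, hw]; ring
      have hzi : IsIntegral ℤ (2 * z - x) := by
        apply IsIntegral.of_pow (n := 2) (by norm_num)
        rw [hz2]; exact π.2
      exact aux_pi_not_sq p hp hp0 h hodd π ⟨2 * z - x, hzi⟩ hg (RingOfIntegers.ext hz2)
    · exact h0
  have hmin : minpoly (𝓞 F) ω = f := by
    have hd := minpoly.isIntegrallyClosed_dvd hωint hfω
    symm
    apply Polynomial.eq_of_monic_of_dvd_of_natDegree_le (minpoly.monic hωint) hfm hd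
    have h1 := IntermediateField.adjoin.finrank (K := F) (x := w) hwint'.tower_top
    rw [hint, IntermediateField.finrank_top', hdeg] at h1
    rw [hfd, h1, ← hωw, minpoly.isIntegrallyClosed_eq_field_fractions F k hωint]
    exact Polynomial.natDegree_map_le
  have hadj : Algebra.adjoin F {algebraMap (𝓞 k) k ω} = ⊤ := by
    rw [hωw, ← IntermediateField.adjoin_simple_toSubalgebra_of_isAlgebraic
      (hwint'.tower_top.isAlgebraic), hint, IntermediateField.top_toSubalgebra]
  have hdiff := aeval_derivative_mem_differentIdeal (𝓞 F) F k ω hadj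
  rw [hmin] at hdiff
  have hqm : q.IsMaximal := hq.isMaximal hq0
  have hdvd := pow_sub_one_dvd_differentIdeal (𝓞 F) P 2 hq0 (Ideal.dvd_iff_le.2 hle)
  rw [show 2 - 1 = 1 from rfl, pow_one] at hdvd
  have hmem := Ideal.dvd_iff_le.1 hdvd hdiff
  have hsq : (Polynomial.aeval ω (Polynomial.derivative f)) ^ 2 = algebraMap (𝓞 F) (𝓞 k) π := by
    apply RingOfIntegers.ext
    have : algebraMap (𝓞 k) k (algebraMap (𝓞 F) (𝓞 k) π) = algebraMap F k (algebraMap (𝓞 F) F π) := rfl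
    change algebraMap (𝓞 k) k _ = algebraMap (𝓞 k) k _
    rw [this, hc']
    have h3 : algebraMap (𝓞 k) k (algebraMap (𝓞 F) (𝓞 k) ξ) = algebraMap F k x := rfl
    have h4 : algebraMap F k 4 = 4 := map_ofNat _ 4
    simp [f, h3, hωw, h4]
    rw [← hβ, hw]; ring
  have hπP : algebraMap (𝓞 F) (𝓞 k) π ∈ P := by
    rw [← hsq]; exact P.pow_mem_of_mem hmem 2 (by norm_num)
  have hπq : π ∈ q := by
    rw [hPq.over]; exact hπP
  have : p ^ h ≤ q := by
    rw [hg, Ideal.span_singleton_le_iff_mem]; exact hπq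
  have hpq : p ≤ q := hq.le_of_pow_le this
  exact hqp ((hp.isMaximal hp0).eq_of_le hq.ne_top hpq).symm

lemma aux_even (F : Type*) [Field F] [NumberField F] (k : Type*) [Field k] [NumberField k]
    [Algebra F k] (hdeg : Module.finrank F k = 2)
    (p : Ideal (𝓞 F)) (hp : p.IsPrime) (hp0 : p ≠ ⊥) (h : ℕ) (hodd : Odd h) (π ξ c : 𝓞 F)
    (hg : p ^ h = Ideal.span {π}) (hc : π - ξ ^ 2 = 4 * c)
    (β : k) (hβ : β ^ 2 = algebraMap F k (algebraMap (𝓞 F) F π))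
    (I : Ideal (𝓞 F)) (hI : I ≠ ⊥) (J : Ideal (𝓞 k))
    (hIJ : I.map (algebraMap (𝓞 F) (𝓞 k)) = J ^ 2)
    (q : Ideal (𝓞 F)) (hq : q.IsPrime) (hq0 : q ≠ ⊥) (hqp : q ≠ p) :
    ∃ n : ℕ, emultiplicity q I = 2 * n := by
  have hqm : q.IsMaximal := hq.isMaximal hq0
  obtain ⟨P, hPm, hPq⟩ := Ideal.exists_maximal_ideal_liesOver_of_isIntegral (S := 𝓞 k) q
  have hPp : P.IsPrime := hPm.isPrime
  have hnot := aux_unram F k hdeg p hp hp0 h hodd π ξ c hg hc β hβ q hq hq0 hqp P hPp hPq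
  have hle : q.map (algebraMap (𝓞 F) (𝓞 k)) ≤ P := by
    rw [Ideal.map_le_iff_le_comap, hPq.over]
  have hP0 : P ≠ ⊥ := Ideal.ne_bot_of_liesOver_of_ne_bot hq0 P
  have hram : q.ramificationIdx' P = 1 := by
    by_contra hr
    exact hnot ((Ideal.ramificationIdx'_ne_one_iff hle).1 hr)
  have hPi := Ideal.prime_of_isPrime hP0 hPp
  have hJ0 : J ≠ ⊥ := by
    rintro rfl
    apply Ideal.map_ne_bot_of_ne_bot (S := 𝓞 k) hI
    rw [hIJ]; simp
  have h1 := Ideal.IsDedekindDomain.emultiplicity_map_eq_ramificationIdx'_mul hI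
    (Ideal.prime_of_isPrime hq0 hq).irreducible hPi.irreducible hP0 (w := P)
  rw [hIJ, hram, emultiplicity_pow hPi,
    UniqueFactorizationMonoid.emultiplicity_eq_count_normalizedFactors hPi.irreducible hJ0] at h1
  exact ⟨_, by simpa using h1.symm⟩

lemma aux_main (F : Type*) [Field F] [NumberField F] (k : Type*) [Field k] [NumberField k]
    [Algebra F k] (hdeg : Module.finrank F k = 2) (hodd : Odd (NumberField.classNumber F))
    (p : Ideal (𝓞 F)) (hp : p.IsPrime) (hp0 : p ≠ ⊥) (π ξ c : 𝓞 F)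
    (hg : p ^ (NumberField.classNumber F) = Ideal.span {π}) (hc : π - ξ ^ 2 = 4 * c)
    (β : k) (hβ : β ^ 2 = algebraMap F k (algebraMap (𝓞 F) F π))
    (η : (𝓞 k)ˣ) (hη : RingOfIntegers.norm F (η : 𝓞 k) = 1) :
    ∃ (u : (𝓞 F)ˣ) (γ : 𝓞 k), (η : 𝓞 k) ^ (NumberField.classNumber F) =
      γ ^ 2 * algebraMap (𝓞 F) (𝓞 k) u := by
  obtain ⟨s, hs⟩ := aux_trace F k hdeg η hη
  by_cases hs0 : s = 0
  · have h1 : (η : 𝓞 k) = -1 := by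
      rw [hs0, map_zero, mul_zero] at hs
      have := pow_eq_zero_iff (two_ne_zero) |>.1 hs.symm
      linear_combination this
    refine ⟨-1, 1, ?_⟩
    rw [h1, hodd.neg_one_pow]; simp
  set h := NumberField.classNumber F with hh
  have hI0 : Ideal.span {s} ≠ ⊥ := by simpa using hs0
  have hmap : (Ideal.span {s}).map (algebraMap (𝓞 F) (𝓞 k)) = (Ideal.span {1 + (η : 𝓞 k)}) ^ 2 := by
    rw [Ideal.map_span, Set.image_singleton, Ideal.span_singleton_pow, ← hs,
      Ideal.span_singleton_mul_left_unit η.isUnit]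
  obtain ⟨J, n, hJ⟩ := aux_sq_factor (Ideal.span {s}) p hI0 (fun q hq hq0 hqp =>
    aux_even F k hdeg p hp hp0 h hodd π ξ c hg hc β hβ _ hI0 _ hmap q hq hq0 hqp)
  have hJ0 : J ≠ ⊥ := by
    rintro rfl
    apply hI0; rw [hJ]; simp
  have hJp : (J ^ h).IsPrincipal := by
    rw [← ClassGroup.mk0_eq_one_iff (pow_mem (mem_nonZeroDivisors_of_ne_zero hJ0) h),
      ← SubmonoidClass.mk_pow J (mem_nonZeroDivisors_of_ne_zero hJ0), map_pow, hh]
    exact pow_card_eq_one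
  obtain ⟨b, hb⟩ := hJp
  replace hb : J ^ h = Ideal.span {b} := hb
  have hass : Ideal.span {s ^ h} = Ideal.span {b ^ 2 * π ^ n} := by
    rw [← Ideal.span_singleton_pow, hJ, mul_pow, ← pow_mul, mul_comm 2 h, pow_mul, hb, ← pow_mul,
      mul_comm n h, pow_mul, hg, Ideal.span_singleton_pow, Ideal.span_singleton_pow,
      Ideal.span_singleton_mul_span_singleton]
  obtain ⟨u, hu⟩ := Ideal.span_singleton_eq_span_singleton.1 hass
  have hinj : Function.Injective (fun x : 𝓞 F => algebraMap F k (algebraMap (𝓞 F) F x)) :=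
    (algebraMap F k).injective.comp RingOfIntegers.coe_injective
  let φ : 𝓞 F →+* k := (algebraMap F k).comp (algebraMap (𝓞 F) F)
  have hφinj : Function.Injective φ := hinj
  have hφ : ∀ x, algebraMap (𝓞 k) k (algebraMap (𝓞 F) (𝓞 k) x) = φ x := fun x => rfl
  have hπ' : β ^ 2 = φ π := hβ
  have hne : b ^ 2 * π ^ n ≠ 0 := by
    rw [← hu]; exact mul_ne_zero (pow_ne_zero _ hs0) u.ne_zero
  have hne' : (φ b * β ^ n) ^ 2 ≠ 0 := by
    have : φ (b ^ 2 * π ^ n) ≠ 0 := by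
      rw [Ne, map_eq_zero_iff φ hφinj]; exact hne
    rw [map_mul, map_pow, map_pow, ← hπ'] at this
    convert this using 1; ring
  set e : k := algebraMap (𝓞 k) k η with he
  have h1 : e * φ s = (1 + e) ^ 2 := by
    have := congrArg (algebraMap (𝓞 k) k) hs
    simpa [hφ] using this
  have h2 : φ s ^ h * φ u = (φ b * β ^ n) ^ 2 := by
    have := congrArg φ hu
    simp only [map_mul, map_pow, ← hπ'] at this
    rw [this]; ring
  have huu : φ u * φ (u⁻¹ : (𝓞 F)ˣ) = 1 := by rw [← map_mul]; simp
  set g : k := (1 + e) ^ h / (φ b * β ^ n) with hgdef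
  have hg2 : g ^ 2 = e ^ h * φ (u⁻¹ : (𝓞 F)ˣ) := by
    rw [hgdef, div_pow, div_eq_iff hne', ← h2, ← pow_mul, mul_comm h 2, pow_mul, ← h1, mul_pow]
    linear_combination (-(e ^ h * φ s ^ h)) * huu
  have hgint : IsIntegral ℤ g := by
    apply IsIntegral.of_pow (n := 2) (by norm_num)
    rw [hg2]
    exact ((RingOfIntegers.isIntegral_coe (η : 𝓞 k)).pow _).mul
      (RingOfIntegers.isIntegral_coe (algebraMap (𝓞 F) (𝓞 k) (u⁻¹ : (𝓞 F)ˣ)))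
  obtain ⟨γ, hγ⟩ : ∃ γ : 𝓞 k, algebraMap (𝓞 k) k γ = g := ⟨⟨g, hgint⟩, rfl⟩
  refine ⟨u, γ, ?_⟩
  apply RingOfIntegers.ext
  simp only [map_mul, map_pow]
  rw [hφ, hγ, hg2, ← he]
  linear_combination (-(e ^ h)) * huu

lemma aux_symbol (F : Type*) [Field F] [NumberField F] (k : Type*) [Field k] [NumberField k]
    [Algebra F k] (p : Ideal (𝓞 F)) (hp : p.IsPrime) (hp0 : p ≠ ⊥)
    (hN : Odd (Ideal.absNorm p)) (hprim : IsPrimaryIdeal F p)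
    (P : Ideal (𝓞 k)) (hP : P.IsPrime) (hP0 : P ≠ ⊥)
    (hle : Ideal.map (algebraMap (𝓞 F) (𝓞 k)) p ≤ P)
    (η : (𝓞 k)ˣ) (h : ℕ) (hodd : Odd h) (u : (𝓞 F)ˣ) (γ : 𝓞 k)
    (heq : (η : 𝓞 k) ^ h = γ ^ 2 * algebraMap (𝓞 F) (𝓞 k) u) :
    (η : 𝓞 k) ^ ((Ideal.absNorm P - 1) / 2) - 1 ∈ P := by
  have hPm : P.IsMaximal := hP.isMaximal hP0
  have hover : P.LiesOver p := by
    constructor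
    exact (hp.isMaximal hp0).eq_of_le (Ideal.IsPrime.under (𝓞 F) P).ne_top
      (Ideal.map_le_iff_le_comap.1 hle)
  have hNP := Ideal.absNorm_eq_pow_inertiaDeg'_of_liesOver P p hp hp0
  have hNodd : Odd (Ideal.absNorm P) := by rw [hNP]; exact hN.pow
  have hdvd : (Ideal.absNorm p - 1) / 2 ∣ (Ideal.absNorm P - 1) / 2 := by
    apply Nat.div_dvd_div (hN.tsub_odd odd_one).two_dvd
    rw [hNP]
    simpa using Nat.sub_dvd_pow_sub_pow (Ideal.absNorm p) 1 (p.inertiaDeg' P)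
  obtain ⟨m, hm⟩ := (hNodd.tsub_odd odd_one).two_dvd
  have hm' : (Ideal.absNorm P - 1) / 2 = m := by omega
  rw [hm'] at hdvd ⊢
  have hu0 : (u : 𝓞 F) ^ ((Ideal.absNorm p - 1) / 2) - 1 ∈ p := by
    have := hprim u
    unfold quadResSym at this
    by_contra hcon
    rw [if_neg hcon] at this
    norm_num at this
  let : Field (𝓞 k ⧸ P) := Ideal.Quotient.field P
  have : Finite (𝓞 k ⧸ P) := Ideal.finiteQuotientOfFreeOfNeBot P hP0
  let : Fintype (𝓞 k ⧸ P) := Fintype.ofFinite _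
  have hcard : Fintype.card (𝓞 k ⧸ P) = Ideal.absNorm P := by
    rw [Ideal.absNorm_apply, Submodule.cardQuot_apply, Nat.card_eq_fintype_card]
  let ψ := Ideal.Quotient.mk P
  have hfermat : ∀ x : 𝓞 k ⧸ P, x ≠ 0 → x ^ (2 * m) = 1 := by
    intro x hx
    rw [← hm, ← hcard]; exact FiniteField.pow_card_sub_one_eq_one x hx
  have hu1 : ψ (algebraMap (𝓞 F) (𝓞 k) u) ^ m = 1 := by
    obtain ⟨d, hd⟩ := hdvd
    have h3 : algebraMap (𝓞 F) (𝓞 k) ((u : 𝓞 F) ^ ((Ideal.absNorm p - 1) / 2) - 1) ∈ P :=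
      hle (Ideal.mem_map_of_mem _ hu0)
    have h4 := (Ideal.Quotient.eq_zero_iff_mem).2 h3
    rw [map_sub, map_sub, map_one, map_one, sub_eq_zero, map_pow, map_pow] at h4
    rw [hd, pow_mul]
    change ((Ideal.Quotient.mk P) _ ^ _) ^ d = 1
    rw [h4, one_pow]
  have hη0 : ψ η ≠ 0 := (η.isUnit.map ψ).ne_zero
  have h5 : ψ η ^ h = ψ γ ^ 2 * ψ (algebraMap (𝓞 F) (𝓞 k) u) := by
    rw [← map_pow, heq]; simp
  have hγ0 : ψ γ ≠ 0 := by
    intro h0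
    rw [h0] at h5
    exact pow_ne_zero h hη0 (by rw [h5]; simp)
  have h6 : (ψ η ^ m) ^ h = 1 := by
    rw [← pow_mul, mul_comm, pow_mul, h5, mul_pow, hu1, ← pow_mul, hfermat _ hγ0, one_mul]
  have h7 : (ψ η ^ m) ^ 2 = 1 := by
    rw [← pow_mul, mul_comm]; exact hfermat _ hη0
  have h8 : ψ η ^ m = 1 := by
    obtain ⟨j, rfl⟩ := hodd
    rwa [pow_add, pow_mul, h7, one_pow, one_mul, pow_one] at h6
  rw [← Ideal.Quotient.eq_zero_iff_mem, map_sub, map_pow, map_one, sub_eq_zero]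
  exact h8

/-- Let `𝔭₁, 𝔭₂` be primary prime ideals of odd norm in `F` (odd class number),
`𝔭₁^{h(F)} = (π₁)` with `π₁` primary, `k₁ = F(√π₁)`, and `𝔓₂` a prime of `k₁` above
`𝔭₂`. Then units of `k₁` with equal relative norms have the same quadratic residue
symbol modulo `𝔓₂`; equivalently `[η/𝔓₂] = 1` whenever `N_{k₁/F}(η) = 1`. -/
theorem symbol_depends_only_on_norm
    (F : Type*) [Field F] [NumberField F]
    (hoddF : Odd (NumberField.classNumber F))
    (𝔭₁ 𝔭₂ : Ideal (𝓞 F)) (hp1 : 𝔭₁.IsPrime) (hp2 : 𝔭₂.IsPrime) (hne : 𝔭₁ ≠ 𝔭₂)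
    (hN1 : Odd (Ideal.absNorm 𝔭₁)) (hN2 : Odd (Ideal.absNorm 𝔭₂))
    (hprim1 : IsPrimaryIdeal F 𝔭₁) (hprim2 : IsPrimaryIdeal F 𝔭₂)
    (π₁ : 𝓞 F) (hπ₁ : IsPrimaryElem F π₁)
    (hgen1 : 𝔭₁ ^ NumberField.classNumber F = Ideal.span {π₁})
    (k₁ : Type*) [Field k₁] [NumberField k₁] [Algebra F k₁]
    (hdeg1 : Module.finrank F k₁ = 2)
    (β₁ : k₁) (hβ₁ : β₁ ^ 2 = algebraMap F k₁ (algebraMap (𝓞 F) F π₁))  -- `k₁ = F(√π₁)`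
    (𝔓₂ : Ideal (𝓞 k₁)) (hP2 : 𝔓₂.IsPrime) (hP2ne : 𝔓₂ ≠ ⊥)
    (hP2above : Ideal.map (algebraMap (𝓞 F) (𝓞 k₁)) 𝔭₂ ≤ 𝔓₂)  -- `𝔓₂` lies above `𝔭₂`
    : (∀ η η' : (𝓞 k₁)ˣ,
        RingOfIntegers.norm F (η : 𝓞 k₁) = RingOfIntegers.norm F (η' : 𝓞 k₁) →
        quadResSym k₁ 𝔓₂ (η : 𝓞 k₁) = quadResSym k₁ 𝔓₂ (η' : 𝓞 k₁)) ∧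
      (∀ η : (𝓞 k₁)ˣ, RingOfIntegers.norm F (η : 𝓞 k₁) = 1 →
        quadResSym k₁ 𝔓₂ (η : 𝓞 k₁) = 1) := by
  have hp10 : 𝔭₁ ≠ ⊥ := by
    rintro rfl
    simp at hN1
  have hp20 : 𝔭₂ ≠ ⊥ := by
    rintro rfl
    simp at hN2
  obtain ⟨-, ξ, c, hc⟩ := hπ₁
  have key : ∀ η : (𝓞 k₁)ˣ, RingOfIntegers.norm F (η : 𝓞 k₁) = 1 →
      (η : 𝓞 k₁) ^ ((Ideal.absNorm 𝔓₂ - 1) / 2) - 1 ∈ 𝔓₂ := by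
    intro η hη
    obtain ⟨u, γ, h⟩ := aux_main F k₁ hdeg1 hoddF 𝔭₁ hp1 hp10 π₁ ξ c hgen1 hc β₁ hβ₁ η hη
    exact aux_symbol F k₁ 𝔭₂ hp2 hp20 hN2 hprim2 𝔓₂ hP2 hP2ne hP2above η _ hoddF u γ h
  refine ⟨fun η η' h => ?_, fun η h => by unfold quadResSym; rw [if_pos (key η h)]⟩
  have h1 : RingOfIntegers.norm F ((η * η'⁻¹ : (𝓞 k₁)ˣ) : 𝓞 k₁) = 1 := by
    rw [Units.val_mul, map_mul, h, ← map_mul, ← Units.val_mul]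
    simp
  have h2 := key _ h1
  rw [← Ideal.Quotient.eq_zero_iff_mem, map_sub, map_pow, map_one, sub_eq_zero] at h2
  have h3 : (η : 𝓞 k₁) = ((η * η'⁻¹ : (𝓞 k₁)ˣ) : 𝓞 k₁) * η' := by
    rw [← Units.val_mul]; simp
  have h4 : ((η : 𝓞 k₁) ^ ((Ideal.absNorm 𝔓₂ - 1) / 2) - 1 ∈ 𝔓₂) ↔
      ((η' : 𝓞 k₁) ^ ((Ideal.absNorm 𝔓₂ - 1) / 2) - 1 ∈ 𝔓₂) := by
    rw [← Ideal.Quotient.eq_zero_iff_mem, ← Ideal.Quotient.eq_zero_iff_mem, h3]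
    simp only [map_sub, map_pow, map_one, map_mul, mul_pow, h2, one_mul]
  unfold quadResSym
  simp only [h4]
end

section
/- Let p and q be distinct primes with p ≡ q ≡ 1 (mod 4) and Legendre symbol (p/q) = +1, and let ε_p and ε_q be the fundamental units of ℚ(√p) and ℚ(√q). Then (ε_p/q) = (ε_q/p) = (p/q)₄ (q/p)₄, where (p/q)₄ ∈ {±1} is defined by (p/q)₄ ≡ p^{(q−1)/4} (mod q) and (q/p)₄ ≡ q^{(p−1)/4} (mod p), and (ε_p/q) denotes the quadratic residue symbol [ε_p/𝔮] for a prime ideal 𝔮 of ℚ(√p) above q (independent of the choice). -/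
open NumberField
open scoped Classical

/-- The rational biquadratic residue symbol `(a/q)₄ ∈ {±1}`, defined (when `a` is a
quadratic residue mod `q`) by `(a/q)₄ ≡ a^((q-1)/4) (mod q)`. -/
noncomputable def quarticSym (a q : ℕ) : ℤ :=
  if (a : ZMod q) ^ ((q - 1) / 4) = 1 then 1 else -1

lemma gi_prim : IsPrimitiveRoot (⟨0, 1⟩ : GaussianInt) 4 := by
  have h2 : ((⟨0, 1⟩ : GaussianInt)) ^ 2 = -1 := by
    rw [pow_two]; rfl
  have h := orderOf_eq_prime_pow (p := 2) (n := 1) (x := (⟨0, 1⟩ : GaussianInt))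
    (by rw [pow_one, h2]; decide) (by rw [show 2 ^ (1 + 1) = 2 * 2 by norm_num, pow_mul, h2]; norm_num)
  have h' : orderOf (⟨0, 1⟩ : GaussianInt) = 4 := by rw [h]; norm_num
  rw [← h']
  exact IsPrimitiveRoot.orderOf _

/-- A quartic character with the expected value at `q`. -/
lemma exists_quartic (p q : ℕ) [Fact p.Prime] (hp4 : p % 4 = 1)
    (hq0 : (q : ZMod p) ≠ 0) (hsq : IsSquare (q : ZMod p)) :
    ∃ χ : MulChar (ZMod p) GaussianInt, orderOf χ = 4 ∧
      χ (q : ZMod p) = ((quarticSym q p : ℤ) : GaussianInt) := by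
  have hp := (Fact.out : p.Prime)
  have hp2 := hp.two_le
  obtain ⟨χ, hχ⟩ := MulChar.exists_mulChar_orderOf (ZMod p) (n := 4)
    (by rw [ZMod.card]; omega) gi_prim
  refine ⟨χ, hχ, ?_⟩
  obtain ⟨y, hy⟩ := hsq
  have hy0 : y ≠ 0 := by rintro rfl; simp at hy; exact hq0 hy
  have hχ4 : χ ^ 4 = 1 := by rw [← hχ]; exact pow_orderOf_eq_one χ
  have h2 : χ (q : ZMod p) ^ 2 = 1 := by
    rw [hy, map_mul, ← pow_two, ← pow_mul, ← MulChar.pow_apply' _ (by norm_num), hχ4]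
    exact MulChar.one_apply hy0.isUnit
  obtain ⟨g, hg⟩ := IsCyclic.exists_generator (α := (ZMod p)ˣ)
  have hog : orderOf g = p - 1 := by
    rw [orderOf_eq_card_of_forall_mem_zpowers hg, Nat.card_eq_fintype_card, ZMod.card_units]
  obtain ⟨k, hk⟩ := (mem_powers_iff_mem_zpowers.mpr (hg (Units.mk0 _ hq0)))
  have hk' : ((g : ZMod p)) ^ k = q := by
    have := congrArg Units.val hk
    simpa using this
  have hc (m : ℕ) (hm : m ≠ 0) : χ (g : ZMod p) ^ m = 1 ↔ 4 ∣ m := by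
    rw [← hχ, orderOf_dvd_iff_pow_eq_one, MulChar.eq_iff hg, MulChar.pow_apply' _ hm]
    rw [MulChar.one_apply g.isUnit]
  have key : χ (q : ZMod p) = 1 ↔ (q : ZMod p) ^ ((p - 1) / 4) = 1 := by
    have e1 : χ (q : ZMod p) = 1 ↔ 4 ∣ k := by
      rcases Nat.eq_zero_or_pos k with rfl | hk0
      · simp at hk'; simp [← hk']
      rw [← hk', map_pow, hc k hk0.ne']
    have e2 : (q : ZMod p) ^ ((p - 1) / 4) = 1 ↔ p - 1 ∣ k * ((p - 1) / 4) := by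
      rw [← hk', ← pow_mul, ← hog, orderOf_dvd_iff_pow_eq_one]
      rw [← Units.val_pow_eq_pow_val, Units.val_eq_one]
    rw [e1, e2]
    obtain ⟨m, hm⟩ : 4 ∣ p - 1 := by omega
    have hm0 : 0 < m := by omega
    rw [hm, Nat.mul_div_cancel_left _ (by norm_num)]
    exact (Nat.mul_dvd_mul_iff_right hm0).symm
  unfold quarticSym
  split_ifs with h
  · simpa using key.mpr h
  · rcases sq_eq_sq_iff_eq_or_eq_neg.mp (h2.trans (one_pow 2).symm) with h1 | h1
    · exact absurd (key.mp h1) h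
    · simpa using h1

/-- The Jacobi sum of a quartic character. -/
lemma jacobi_norm (p : ℕ) [Fact p.Prime] (hp4 : p % 4 = 1)
    (χ : MulChar (ZMod p) GaussianInt) (hχ : orderOf χ = 4) :
    Odd (jacobiSum χ χ).re ∧ Even (jacobiSum χ χ).im ∧
    (jacobiSum χ χ).re ^ 2 + (jacobiSum χ χ).im ^ 2 = p := by
  have hp := (Fact.out : p.Prime)
  have hp2 := hp.two_le
  have hχ4 : χ ^ 4 = 1 := by rw [← hχ]; exact pow_orderOf_eq_one χ
  obtain ⟨z, -, hz⟩ := exists_jacobiSum_eq_neg_one_add (n := 4) (by norm_num) hχ4 hχ4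
    (by rw [ZMod.card]; omega) gi_prim
  have hI : ((⟨0, 1⟩ : GaussianInt) - 1) ^ 2 = ⟨0, -2⟩ := by rw [pow_two]; rfl
  rw [hI] at hz
  refine ⟨?_, ?_, ?_⟩
  · rw [hz]; simp [Int.odd_iff]
  · rw [hz]; simp 
  · have h1 : χ ≠ 1 := by rintro rfl; simp at hχ
    have h2 : χ * χ ≠ 1 := by
      intro h
      have : orderOf χ ∣ 2 := orderOf_dvd_of_pow_eq_one (by rw [pow_two, h])
      rw [hχ] at this; revert this; decide
    have inj : Function.Injective GaussianInt.toComplex := by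
      intro a b h; exact GaussianInt.toComplex_inj.mp h
    have h := jacobiSum_mul_jacobiSum_inv (F := ZMod p) (F' := ℂ)
      (χ := χ.ringHomComp GaussianInt.toComplex) (φ := χ.ringHomComp GaussianInt.toComplex)
      (by rw [ZMod.ringChar_zmod_n]; simp [ringChar.eq_zero]; exact hp.ne_zero.symm)
      ((MulChar.ringHomComp_ne_one_iff inj).mpr h1) ((MulChar.ringHomComp_ne_one_iff inj).mpr h1)
      (by rw [← MulChar.ringHomComp_mul]; exact (MulChar.ringHomComp_ne_one_iff inj).mpr h2)
    have h3 : jacobiSum (χ.ringHomComp GaussianInt.toComplex)⁻¹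
        (χ.ringHomComp GaussianInt.toComplex)⁻¹ =
        star (jacobiSum (χ.ringHomComp GaussianInt.toComplex)
          (χ.ringHomComp GaussianInt.toComplex)) := by
      simp [jacobiSum, ← MulChar.star_eq_inv, MulChar.star_apply]
    rw [h3, jacobiSum_ringHomComp, ZMod.card] at h
    generalize jacobiSum χ χ = J at h
    rw [RCLike.star_def, Complex.mul_conj, Complex.normSq_apply] at h
    rw [GaussianInt.re_toComplex, GaussianInt.im_toComplex] at h
    simp only [← pow_two] at h
    exact_mod_cast h

lemma scholzA (p q : ℕ) [Fact p.Prime] [Fact q.Prime] (hpq : p ≠ q)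
    (hp4 : p % 4 = 1) (hq4 : q % 4 = 1)
    (hsq : IsSquare (q : ZMod p)) :
    ∃ a b : ℤ, Odd a ∧ Even b ∧ a ^ 2 + b ^ 2 = p ∧ ∀ i : ZMod q, i ^ 2 = -1 →
      (p : ZMod q) ^ ((q - 1) / 4) * ((a : ZMod q) + b * i) ^ ((q - 1) / 2)
        = (quarticSym q p : ZMod q) := by
  have hp := (Fact.out : p.Prime)
  have hq := (Fact.out : q.Prime)
  have hq0 : (q : ZMod p) ≠ 0 := by
    rw [Ne, ZMod.natCast_eq_zero_iff]
    intro h; exact hpq ((Nat.prime_dvd_prime_iff_eq hp hq).mp h)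
  obtain ⟨χ, hχ, hχq⟩ := exists_quartic p q hp4 hq0 hsq
  obtain ⟨ha, hb, hn⟩ := jacobi_norm p hp4 χ hχ
  refine ⟨_, _, ha, hb, hn, ?_⟩
  intro i hi
  have hch : ringChar (ZMod q) ≠ ringChar (ZMod p) := by
    rw [ZMod.ringChar_zmod_n, ZMod.ringChar_zmod_n]; exact hpq.symm
  let ψ := AddChar.FiniteField.primitiveChar (ZMod p) (ZMod q) hch
  let L := CyclotomicField ψ.n (ZMod q)
  let f : GaussianInt →+* ZMod q := Zsqrtd.lift ⟨i, by rw [← pow_two, hi]; simp⟩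
  have hf : ∀ z : GaussianInt, f z = z.re + z.im * i := fun z => rfl
  let F : GaussianInt →+* L := (algebraMap (ZMod q) L).comp f
  have hF : ∀ z : GaussianInt, F z = algebraMap (ZMod q) L (z.re + z.im * i) := fun z => rfl
  have hinj := (algebraMap (ZMod q) L).injective
  have : CharP L q := charP_of_injective_algebraMap hinj q
  let χ' : MulChar (ZMod p) L := χ.ringHomComp F
  have hχ4 : χ ^ 4 = 1 := by rw [← hχ]; exact pow_orderOf_eq_one χ
  have h4 : χ' ^ 4 = 1 := by
    ext u
    rw [MulChar.pow_apply' _ (by norm_num), MulChar.ringHomComp_apply, ← map_pow,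
      ← MulChar.pow_apply' _ (by norm_num), hχ4]
    simp
  have h2 : χ' * χ' ≠ 1 := by
    intro h
    have h2' : χ * χ ≠ 1 := by
      intro h
      have : orderOf χ ∣ 2 := orderOf_dvd_of_pow_eq_one (by rw [pow_two, h])
      rw [hχ] at this; revert this; decide
    apply h2'
    refine MulChar.ext fun u => ?_
    have hu : (χ * χ) u ^ 2 = 1 := by
      rw [MulChar.mul_apply, ← pow_two, ← pow_mul, ← MulChar.pow_apply' _ (by norm_num), hχ4]
      exact MulChar.one_apply u.isUnit
    have hv : F ((χ * χ) u) = 1 := by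
      have := congrArg (fun θ : MulChar (ZMod p) L => θ u) h
      simp only [MulChar.mul_apply, MulChar.one_apply u.isUnit] at this
      rw [MulChar.mul_apply, map_mul]; exact this
    rw [MulChar.one_apply u.isUnit]
    rcases sq_eq_sq_iff_eq_or_eq_neg.mp (hu.trans (one_pow 2).symm) with h1 | h1
    · exact h1
    · rw [h1, map_neg, map_one] at hv
      exact absurd hv (Ring.neg_one_ne_one_of_char_ne_two (by rw [ringChar.eq L q]; omega))
  have hs := jacobiSum_mul_nontrivial h2 ψ.char
  have hJ : jacobiSum χ' χ' = algebraMap (ZMod q) L ((jacobiSum χ χ).re + (jacobiSum χ χ).im * i) := by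
    rw [jacobiSum_ringHomComp, hF]
  have hquad : (χ' * χ').IsQuadratic := by
    intro u
    rcases eq_or_ne u 0 with rfl | hu
    · left; exact MulChar.map_zero _
    · right
      have hu : (χ' * χ') u ^ 2 = 1 := by
        rw [MulChar.mul_apply, ← pow_two, ← pow_mul, ← MulChar.pow_apply' _ (by norm_num), h4]
        exact MulChar.one_apply hu.isUnit
      exact sq_eq_sq_iff_eq_or_eq_neg.mp (hu.trans (one_pow 2).symm)
  have hg2 := gaussSum_sq h2 hquad ψ.prim
  have hm1 : (χ' * χ') (-1) = 1 := by
    rw [MulChar.mul_apply, ← map_mul]; simp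
  rw [hm1, one_mul, ZMod.card] at hg2
  have hfr := gaussSum_frob q χ' ψ.char
  have hχq' : χ' ^ q = χ' := by
    obtain ⟨m, hm⟩ : ∃ m, q = 4 * m + 1 := ⟨q / 4, by omega⟩
    have : χ' ^ (4 * m + 1) = χ' := by rw [pow_succ, pow_mul, h4, one_pow, one_mul]
    exact (congrArg (fun n => χ' ^ n) hm).trans this
  rw [hχq', AddChar.pow_mulShift] at hfr
  have hms := gaussSum_mulShift χ' ψ.char (Units.mk0 (q : ZMod p) hq0)
  rw [Units.val_mk0, ← hfr] at hms
  have hcq : χ' (q : ZMod p) = ((quarticSym q p : ℤ) : L) := by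
    rw [MulChar.ringHomComp_apply, hχq]; simp
  rw [hcq] at hms
  have hp0 : (p : L) ≠ 0 := by
    rw [Ne, CharP.cast_eq_zero_iff L q]
    intro h; exact hpq ((Nat.prime_dvd_prime_iff_eq hq hp).mp h).symm
  have hτ0 : gaussSum χ' ψ.char ≠ 0 := by
    apply gaussSum_ne_zero_of_nontrivial (by rw [ZMod.card]; exact hp0) _ ψ.prim
    intro h; apply h2; rw [h, one_mul]
  have hsym : ((quarticSym q p : ℤ) : L) * ((quarticSym q p : ℤ) : L) = 1 := by
    unfold quarticSym; split_ifs <;> push_cast <;> ring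
  obtain ⟨m, hm⟩ : ∃ m, q = 4 * m + 1 := ⟨q / 4, by omega⟩
  have e1 : (q - 1) / 4 = m := by omega
  have e2 : (q - 1) / 2 = 2 * m := by omega
  rw [e1, e2]
  apply hinj
  rw [map_mul, map_pow, map_pow, ← hJ, map_natCast, ← hg2, map_intCast]
  have h5 : gaussSum χ' ψ.char ^ (4 * m) = ((quarticSym q p : ℤ) : L) := by
    apply mul_right_cancel₀ hτ0
    rw [← pow_succ, ← hm]
    linear_combination ((quarticSym q p : ℤ) : L) * hms - gaussSum χ' ψ.char ^ q * hsym
  rw [← h5, ← pow_mul, ← mul_pow, hs]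
  ring
lemma neg_pell (p : ℕ) (hp : p.Prime) (hp4 : p % 4 = 1) :
    ∃ s r : ℤ, s ^ 2 + 1 = p * r ^ 2 := by
  have hpp : Prime (p : ℤ) := Nat.prime_iff_prime_int.mp hp
  obtain ⟨A, hA⟩ := Pell.IsFundamental.exists_of_not_isSquare (d := (p : ℤ))
    (by exact_mod_cast hp.pos) hpp.irreducible.not_isSquare
  have hx := hA.1
  have hy := hA.2.1
  have hxy := A.prop_x
  have hmin : ∀ t s : ℤ, t ^ 2 - p * s ^ 2 = 1 → 1 < t → A.x ≤ t := by
    intro t s h ht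
    have := hA.x_le_x (a := Pell.Solution₁.mk t s h) (by simpa using ht)
    simpa using this
  generalize A.x = x at *
  generalize A.y = y at *
  have hyev : y % 2 = 0 := by
    by_contra h
    obtain ⟨w, hw⟩ : ∃ w, y = 2 * w + 1 := ⟨y / 2, by omega⟩
    obtain ⟨P, hP⟩ : ∃ P : ℤ, (p : ℤ) = 4 * P + 1 := ⟨p / 4, by omega⟩
    rcases Int.even_or_odd' x with ⟨k, hk | hk⟩
    · have : (4 : ℤ) * (k ^ 2 - (4 * P + 1) * (w ^ 2 + w) - P) = 2 := by
        rw [hP, hw, hk] at hxy; linear_combination hxy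
      omega
    · have : (4 : ℤ) * (k ^ 2 + k - (4 * P + 1) * (w ^ 2 + w) - P) = 1 := by
        rw [hP, hw, hk] at hxy; linear_combination hxy
      omega
  obtain ⟨w, hw⟩ : ∃ w, y = 2 * w := ⟨y / 2, by omega⟩
  obtain ⟨k, hk⟩ : ∃ k, x = 2 * k + 1 := by
    rcases Int.even_or_odd' x with ⟨k, hk | hk⟩
    · exfalso
      have : (4 : ℤ) * (k ^ 2 - p * w ^ 2) = 1 := by
        rw [hw, hk] at hxy; linear_combination hxy
      omega
    · exact ⟨k, hk⟩
  have hkw : k * (k + 1) = p * w ^ 2 := by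
    rw [hw, hk] at hxy
    linarith [hxy]
  have hk0 : 0 < k := by omega
  have hp0 : (p : ℤ) ≠ 0 := hpp.ne_zero
  have hppos : (0 : ℤ) < p := by exact_mod_cast hp.pos
  have hcop : IsCoprime k (k + 1) := ⟨-1, 1, by ring⟩
  have sqpos : ∀ a b c : ℤ, IsCoprime a b → a * b = c ^ 2 → 0 < a → ∃ d, a = d ^ 2 := by
    intro a b c h1 h2 h3
    obtain ⟨d, hd | hd⟩ := Int.sq_of_isCoprime h1 h2
    · exact ⟨d, hd⟩
    · nlinarith [sq_nonneg d]
  rcases hpp.dvd_or_dvd (⟨w ^ 2, hkw⟩ : (p : ℤ) ∣ k * (k + 1)) with ⟨c, hc⟩ | ⟨c, hc⟩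
  · exfalso
    have h1 : c * (k + 1) = w ^ 2 := by
      apply mul_left_cancel₀ hp0; rw [← hkw, hc]; ring
    have hc0 : 0 < c := by
      by_contra h; nlinarith
    have hcc : IsCoprime c (k + 1) := hcop.of_isCoprime_of_dvd_left ⟨p, by rw [hc]; ring⟩
    obtain ⟨s, hs⟩ := sqpos _ _ _ hcc h1 hc0
    obtain ⟨t, ht⟩ := sqpos (k + 1) c w hcc.symm (by rw [← h1]; ring) (by omega)
    have hm := hmin |t| s (by rw [sq_abs, ← ht, ← hs, ← hc]; ring) (by
      by_contra h
      have : |t| ^ 2 ≤ 1 := by nlinarith [abs_nonneg t]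
      rw [sq_abs] at this; omega)
    have : x ^ 2 ≤ t ^ 2 := by rw [← sq_abs t]; nlinarith
    nlinarith
  · have h1 : c * k = w ^ 2 := by
      apply mul_left_cancel₀ hp0; rw [← hkw, hc]; ring
    have hc0 : 0 < c := by
      by_contra h; nlinarith
    have hcc : IsCoprime c k := hcop.symm.of_isCoprime_of_dvd_left ⟨p, by rw [hc]; ring⟩
    obtain ⟨r, hr⟩ := sqpos _ _ _ hcc h1 hc0
    obtain ⟨s, hs⟩ := sqpos k c w hcc.symm (by rw [← h1]; ring) hk0
    exact ⟨s, r, by rw [← hs, ← hr, hc]⟩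

lemma gauss_factor (p : ℕ) (hp : p.Prime) (s r a b : ℤ)
    (h : s ^ 2 + 1 = p * r ^ 2) (hab : a ^ 2 + b ^ 2 = p) (hb : Even b) :
    ∃ b' m n : ℤ, (b' = b ∨ b' = -b) ∧ 2 * s = a * (m ^ 2 - n ^ 2) - 2 * b' * m * n ∧
      2 = 2 * a * m * n + b' * (m ^ 2 - n ^ 2) := by
  have hpp : Prime (p : ℤ) := Nat.prime_iff_prime_int.mp hp
  have hp0 : (p : ℤ) ≠ 0 := hpp.ne_zero
  obtain ⟨b', hb', hd⟩ : ∃ b', (b' = b ∨ b' = -b) ∧ (p : ℤ) ∣ a - s * b' := by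
    have : (p : ℤ) ∣ (a - s * b) * (a - s * (-b)) :=
      ⟨1 - r ^ 2 * b ^ 2, by linear_combination hab - b ^ 2 * h⟩
    rcases hpp.dvd_or_dvd this with h | h
    · exact ⟨b, Or.inl rfl, h⟩
    · exact ⟨-b, Or.inr rfl, h⟩
  have hab' : a ^ 2 + b' ^ 2 = p := by rcases hb' with rfl | rfl <;> [exact hab; (rw [← hab]; ring)]
  have hbe : Even b' := by rcases hb' with rfl | rfl <;> [exact hb; exact hb.neg]
  obtain ⟨v, hv⟩ := hd
  obtain ⟨u, hu⟩ : (p : ℤ) ∣ s * a + b' := ⟨s * v + r ^ 2 * b', by linear_combination s * hv + b' * h⟩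
  have e1 : a * u - b' * v = s := by
    apply mul_left_cancel₀ hp0; linear_combination -a * hu + b' * hv + s * hab'
  have e2 : a * v + b' * u = 1 := by
    apply mul_left_cancel₀ hp0; linear_combination -a * hv - b' * hu + hab'
  have e3 : u ^ 2 + v ^ 2 = r ^ 2 := by
    apply mul_left_cancel₀ hp0
    rw [← h, ← e1, ← hab']
    linear_combination (a * v + b' * u + 1) * e2
  have hvo : Odd v := by
    rcases Int.even_or_odd v with hv | hv
    · exfalso
      have : Even (1 : ℤ) := by rw [← e2]; exact (hv.mul_left a).add (hbe.mul_right u)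
      revert this; decide
    · exact hv
  have hue : Even u := by
    rcases Int.even_or_odd u with hu' | ⟨u', hu'⟩
    · exact hu'
    · exfalso
      obtain ⟨v', hv'⟩ := hvo
      rcases Int.even_or_odd' r with ⟨k, hk | hk⟩
      · have : (4 : ℤ) * (k ^ 2 - u' ^ 2 - u' - v' ^ 2 - v') = 2 := by
          rw [hu', hv', hk] at e3; linear_combination -e3
        omega
      · have : (4 : ℤ) * (k ^ 2 + k - u' ^ 2 - u' - v' ^ 2 - v') = 1 := by
          rw [hu', hv', hk] at e3; linear_combination -e3
        omega
  set R := |r| with hR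
  have e4 : u ^ 2 + v ^ 2 = R ^ 2 := by rw [hR, sq_abs, e3]
  have hRn : 0 ≤ R := abs_nonneg r
  have hprod : (R + u) * (R - u) = v ^ 2 := by linear_combination -e4
  have hcuv : IsCoprime u v := ⟨b', a, by linear_combination e2⟩
  have hv2 : IsCoprime (2 : ℤ) v := by
    obtain ⟨k, hk⟩ := hvo
    exact ⟨-k, 1, by rw [hk]; ring⟩
  have hcop : IsCoprime (R + u) (R - u) := by
    -- any common divisor is coprime to `2 * u`
    have h1 : IsCoprime (2 * u) (v ^ 2) := (hv2.mul_left hcuv).pow_right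
    rw [← hprod] at h1
    have h2 : IsCoprime (2 * u) (R - u) := h1.of_mul_right_right
    have : R + u = 2 * u + (R - u) * 1 := by ring
    rw [this]
    exact IsCoprime.add_mul_left_left h2 1
  have hv0 : v ≠ 0 := by rintro rfl; revert hvo; decide
  have hvpos : 0 < v ^ 2 := by positivity
  have hpos1 : 0 < R + u := by
    by_contra hc
    have : 0 ≤ R - u := by linarith
    nlinarith
  have hpos2 : 0 < R - u := by
    by_contra hc
    nlinarith
  have sqpos : ∀ a b c : ℤ, IsCoprime a b → a * b = c ^ 2 → 0 < a → ∃ d, a = d ^ 2 := by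
    intro a b c h1 h2 h3
    obtain ⟨d, hd | hd⟩ := Int.sq_of_isCoprime h1 h2
    · exact ⟨d, hd⟩
    · nlinarith [sq_nonneg d]
  obtain ⟨m, hm⟩ := sqpos _ _ _ hcop hprod hpos1
  obtain ⟨n, hn⟩ := sqpos _ _ _ hcop.symm (by rw [mul_comm]; exact hprod) hpos2
  have hu2 : 2 * u = m ^ 2 - n ^ 2 := by linear_combination hm - hn
  have hvv : v ^ 2 = (m * n) ^ 2 := by rw [← hprod, hm, hn]; ring
  rcases sq_eq_sq_iff_eq_or_eq_neg.mp hvv with hvm | hvm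
  · refine ⟨b', m, n, hb', ?_, ?_⟩
    · linear_combination -2 * e1 + a * hu2 - 2 * b' * hvm
    · linear_combination -2 * e2 + b' * hu2 + 2 * a * hvm
  · refine ⟨b', m, -n, hb', ?_, ?_⟩
    · linear_combination -2 * e1 + a * hu2 - 2 * b' * hvm
    · linear_combination -2 * e2 + b' * hu2 + 2 * a * hvm

lemma core (p q : ℕ) [Fact p.Prime] [Fact q.Prime] (hpq : p ≠ q)
    (hp4 : p % 4 = 1) (hq4 : q % 4 = 1)
    (hsq : IsSquare (q : ZMod p)) (x : ZMod q) (hx : x ^ 2 = p) (s r : ℤ)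
    (h : s ^ 2 + 1 = p * r ^ 2) :
    ((s : ZMod q) + r * x) ^ ((q - 1) / 2) = ((quarticSym p q * quarticSym q p : ℤ) : ZMod q) := by
  have hp := (Fact.out : p.Prime)
  have hq := (Fact.out : q.Prime)
  obtain ⟨a, b, ha, hb, hab, hA⟩ := scholzA p q hpq hp4 hq4 hsq
  obtain ⟨b', m, n, hb', h1, h2⟩ := gauss_factor p hp s r a b h hab hb
  obtain ⟨M, hM⟩ : ∃ m, q = 4 * m + 1 := ⟨q / 4, by omega⟩
  have E1 : (q - 1) / 4 = M := by omega
  have E2 : (q - 1) / 2 = 2 * M := by omega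
  have hp0 : (p : ZMod q) ≠ 0 := by
    rw [Ne, ZMod.natCast_eq_zero_iff]
    intro h; exact hpq ((Nat.prime_dvd_prime_iff_eq hq hp).mp h).symm
  have two0 : (2 : ZMod q) ≠ 0 := by
    intro h
    have : ((2 : ℕ) : ZMod q) = 0 := by exact_mod_cast h
    rw [ZMod.natCast_eq_zero_iff] at this
    have := Nat.le_of_dvd (by norm_num) this
    have := hq.two_le
    omega
  have fer (z : ZMod q) (hz : z ≠ 0) : (z ^ 2) ^ (2 * M) = 1 := by
    rw [← pow_mul, show 2 * (2 * M) = q - 1 by omega]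
    exact ZMod.pow_card_sub_one_eq_one hz
  obtain ⟨i₀, hi₀⟩ := ZMod.exists_sq_eq_neg_one_iff (p := q) |>.mpr (by omega)
  obtain ⟨i, hi, hsi⟩ : ∃ i : ZMod q, i ^ 2 = -1 ∧ (s : ZMod q) + i ≠ 0 := by
    by_cases h0 : (s : ZMod q) + i₀ = 0
    · refine ⟨-i₀, by rw [hi₀]; ring, fun h3 => ?_⟩
      have : 2 * i₀ = 0 := by linear_combination h0 - h3
      have h4 := (mul_eq_zero.mp this).resolve_left two0
      rw [h4] at hi₀; simp at hi₀
    · exact ⟨i₀, by rw [hi₀]; ring, h0⟩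
  have hAi : (p : ZMod q) ^ M * ((a : ZMod q) + b' * i) ^ (2 * M) = (quarticSym q p : ZMod q) := by
    rw [E1, E2] at hA
    rcases hb' with rfl | rfl
    · exact hA i hi
    · have := hA (-i) (by rw [neg_sq, hi])
      rw [← this]; push_cast; ring
  have hz := congrArg (Int.cast : ℤ → ZMod q) h
  have h1z := congrArg (Int.cast : ℤ → ZMod q) h1
  have h2z := congrArg (Int.cast : ℤ → ZMod q) h2
  push_cast at hz h1z h2z
  have f1 : 2 * ((s : ZMod q) + i) = (a + b' * i) * (m + n * i) ^ 2 := by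
    linear_combination h1z + i * h2z + (-n^2 * a - 2 * m * n * b' - n ^ 2 * b' * i) * hi
  have f2 : ((s : ZMod q) + i + r * x) ^ 2 = 2 * (s + i) * (s + r * x) := by
    linear_combination r ^ 2 * hx - hz + hi
  have f3 : ((s : ZMod q) + r * x) * (s - r * x) = -1 := by
    linear_combination hz - r ^ 2 * hx
  have hη : (s : ZMod q) + r * x ≠ 0 := by
    intro h; rw [h, zero_mul] at f3
    exact one_ne_zero (neg_eq_zero.mp f3.symm)
  have hmn : (m : ZMod q) + n * i ≠ 0 := by
    intro h; rw [h] at f1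
    exact mul_ne_zero two0 hsi (by rw [f1]; ring)
  have hsirx : (s : ZMod q) + i + r * x ≠ 0 := by
    intro h; rw [h] at f2
    exact mul_ne_zero (mul_ne_zero two0 hsi) hη (by rw [← f2]; ring)
  have g1 : (((s : ZMod q) + r * x)) ^ (2 * M) * (a + b' * i) ^ (2 * M) = 1 := by
    rw [← fer _ hsirx, f2, f1, mul_pow, mul_pow, fer _ hmn]; ring
  have pM : ((p : ZMod q) ^ M) ^ 2 = 1 := by
    rw [← hx, ← pow_mul (x ^ 2), mul_comm M 2]
    apply fer
    rintro rfl; apply hp0; rw [← hx]; ring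
  have pMs : (p : ZMod q) ^ M = ((quarticSym p q : ℤ) : ZMod q) := by
    unfold quarticSym
    rw [E1]
    split_ifs with h
    · simpa using h
    · have := (sq_eq_sq_iff_eq_or_eq_neg.mp (pM.trans (one_pow 2).symm)).resolve_left h
      simpa using this
  have aM : (((a : ZMod q) + b' * i) ^ (2 * M)) ^ 2 = 1 := by
    rw [← pow_mul, mul_comm (2 * M) 2, pow_mul]
    apply fer
    intro h; rw [h] at f1
    exact mul_ne_zero two0 hsi (by rw [f1]; ring)
  rw [E2]
  push_cast
  rw [← hAi, ← pMs]
  linear_combination (a + b' * i : ZMod q) ^ (2 * M) * g1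
    - ((s : ZMod q) + r * x) ^ (2 * M) * aM - (a + b' * i : ZMod q) ^ (2 * M) * pM
lemma side (p q : ℕ) [Fact p.Prime] [Fact q.Prime] (hpq : p ≠ q)
    (hp4 : p % 4 = 1) (hq4 : q % 4 = 1)
    (hsq : IsSquare (q : ZMod p)) (hsq' : IsSquare (p : ZMod q))
    (K : Type*) [Field K] [NumberField K]
    (hdeg : Module.finrank ℚ K = 2) (α : K) (hα : α ^ 2 = (p : K))
    (ε : (𝓞 K)ˣ) (hε : ∀ u : (𝓞 K)ˣ, ∃ n : ℤ, u = ε ^ n ∨ u = -ε ^ n)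
    (𝔮 : Ideal (𝓞 K)) (h𝔮 : 𝔮.IsPrime) (h𝔮q : (q : 𝓞 K) ∈ 𝔮) :
    quadResSym K 𝔮 (ε : 𝓞 K) = quarticSym p q * quarticSym q p := by
  have hp := (Fact.out : p.Prime)
  have hq := (Fact.out : q.Prime)
  have hq2 := hq.two_le
  have hirr : ∀ t : ℚ, t ^ 2 ≠ p := by
    intro t ht
    have : IsSquare (p : ℚ) := ⟨t, by rw [← ht]; ring⟩
    rw [Rat.isSquare_natCast_iff] at this
    exact hp.prime.irreducible.not_isSquare this
  have hlin : ∀ m n : ℚ, (m : K) + n * α = 0 → m = 0 ∧ n = 0 := by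
    intro m n h
    have hn : n = 0 := by
      by_contra hn
      apply hirr (m / n)
      have hnK : (n : K) ≠ 0 := by exact_mod_cast hn
      have : (((m / n) ^ 2 : ℚ) : K) = ((p : ℚ) : K) := by
        push_cast
        rw [← hα, div_pow, div_eq_iff (pow_ne_zero 2 hnK)]
        linear_combination (m - n * α) * h
      exact_mod_cast this
    subst hn
    simp at h
    exact ⟨h, rfl⟩
  have hli : LinearIndependent ℚ ![(1 : K), α] := by
    rw [LinearIndependent.pair_iff]
    intro m n h
    apply hlin
    simpa [Algebra.smul_def] using h
  have hspan : ∀ u : K, ∃ m n : ℚ, u = m + n * α := by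
    intro u
    have := hli.span_eq_top_of_card_eq_finrank' (by simp [hdeg])
    have hu : u ∈ Submodule.span ℚ (Set.range ![(1 : K), α]) := by rw [this]; trivial
    simp only [Matrix.range_cons, Matrix.range_empty, Set.union_empty, Set.singleton_union] at hu
    obtain ⟨m, n, h⟩ := Submodule.mem_span_pair.mp hu
    exact ⟨m, n, by rw [← h]; simp [Algebra.smul_def]⟩
  have htr : Algebra.trace ℚ K α = 0 := by
    have hmin : minpoly ℚ α = Polynomial.X ^ 2 - Polynomial.C (p : ℚ) := by
      symm
      apply minpoly.eq_of_irreducible_of_monic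
      · apply Polynomial.irreducible_of_degree_le_three_of_not_isRoot
        · rw [Polynomial.natDegree_X_pow_sub_C]; decide
        · intro t ht
          apply hirr t
          simpa [sub_eq_zero] using ht
      · simp [hα]
      · exact Polynomial.monic_X_pow_sub_C _ (by norm_num)
    rw [trace_eq_finrank_mul_minpoly_nextCoeff, hmin]
    rw [Polynomial.nextCoeff_of_natDegree_pos (by rw [Polynomial.natDegree_X_pow_sub_C]; norm_num),
      Polynomial.natDegree_X_pow_sub_C]
    simp [Polynomial.coeff_X_pow]
  have hαint : IsIntegral ℤ α := by
    apply IsIntegral.of_pow (n := 2) (by norm_num)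
    rw [hα]
    have := isIntegral_algebraMap (R := ℤ) (A := K) (x := (p : ℤ))
    simpa using this
  obtain ⟨a, ha⟩ : ∃ a : 𝓞 K, (a : K) = α := ⟨⟨α, hαint⟩, rfl⟩
  have ha2 : a ^ 2 = (p : 𝓞 K) := by
    apply RingOfIntegers.ext
    have h1 : algebraMap (𝓞 K) K (a ^ 2) = algebraMap (𝓞 K) K (p : 𝓞 K) := by
      rw [map_pow, map_natCast, ← hα, ← ha]
    exact h1
  have hp0 : (p : ZMod q) ≠ 0 := by
    rw [Ne, ZMod.natCast_eq_zero_iff]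
    intro h; exact hpq ((Nat.prime_dvd_prime_iff_eq hq hp).mp h).symm
  -- choice of the square root
  have hintmem : ∀ z : ℤ, (z : ZMod q) = 0 → (z : 𝓞 K) ∈ 𝔮 := by
    intro z hz
    obtain ⟨w, rfl⟩ := (ZMod.intCast_zmod_eq_zero_iff_dvd z q).mp hz
    push_cast
    exact 𝔮.mul_mem_right _ h𝔮q
  obtain ⟨x, hx, hxa⟩ : ∃ x : ℤ, (x : ZMod q) ^ 2 = p ∧ a - x ∈ 𝔮 := by
    obtain ⟨y, hy⟩ := hsq'
    obtain ⟨x, rfl⟩ := ZMod.intCast_surjective y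
    have : (a - x) * (a + x) ∈ 𝔮 := by
      have h1 : (a - x) * (a + x) = ((p - x ^ 2 : ℤ) : 𝓞 K) := by
        push_cast; rw [← ha2]; ring
      rw [h1]; apply hintmem; push_cast; rw [hy]; ring
    rcases h𝔮.mem_or_mem this with h | h
    · exact ⟨x, by rw [hy]; ring, h⟩
    · exact ⟨-x, by rw [hy]; push_cast; ring, by push_cast; rwa [sub_neg_eq_add]⟩
  have hx0 : (x : ZMod q) ≠ 0 := by
    intro h; rw [h] at hx; apply hp0; rw [← hx]; ring
  have two0 : (2 : ZMod q) ≠ 0 := by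
    intro h
    have : ((2 : ℕ) : ZMod q) = 0 := by exact_mod_cast h
    rw [ZMod.natCast_eq_zero_iff] at this
    have := Nat.le_of_dvd (by norm_num) this
    omega
  have hN : Ideal.absNorm 𝔮 = q := by
    have hle : Ideal.span {(q : 𝓞 K)} ≤ 𝔮 := by
      rw [Ideal.span_singleton_le_iff_mem]; exact h𝔮q
    have hNq : Ideal.absNorm (Ideal.span {(q : 𝓞 K)}) = q ^ 2 := by
      rw [Ideal.absNorm_span_natCast, RingOfIntegers.rank, hdeg]
    have hd := Ideal.absNorm_dvd_absNorm_of_le hle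
    rw [hNq, Nat.dvd_prime_pow hq] at hd
    obtain ⟨k, hk, hk'⟩ := hd
    interval_cases k
    · rw [pow_zero, Ideal.absNorm_eq_one_iff] at hk'
      exact absurd hk' h𝔮.ne_top
    · simpa using hk'
    · exfalso
      obtain ⟨J, hJ⟩ := Ideal.dvd_iff_le.mpr hle
      have hJn := congrArg Ideal.absNorm hJ
      rw [map_mul, hNq, hk'] at hJn
      have hJ1 : Ideal.absNorm J = 1 := by
        have : 0 < q ^ 2 := by positivity
        exact Nat.eq_of_mul_eq_mul_left this (by rw [← hJn, mul_one])
      rw [Ideal.absNorm_eq_one_iff] at hJ1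
      rw [hJ1, Ideal.mul_top] at hJ
      rw [← hJ, Ideal.mem_span_singleton] at hxa
      obtain ⟨β, hβ⟩ := hxa
      have hβ' : α - (x : K) = (q : K) * (β : K) := by
        have := congrArg (algebraMap (𝓞 K) K) hβ
        simpa [ha] using this
      have hti : IsIntegral ℤ (Algebra.trace ℚ K (β : K)) :=
        Algebra.isIntegral_trace (RingOfIntegers.isIntegral_coe β)
      obtain ⟨t, ht⟩ := IsIntegrallyClosed.isIntegral_iff.mp hti
      have h1 := congrArg (Algebra.trace ℚ K) hβ'
      have h2 : (x : K) = algebraMap ℚ K x := by simp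
      have h3 : (q : K) * (β : K) = (q : ℚ) • (β : K) := by simp [Algebra.smul_def]
      rw [map_sub, htr, h2, Algebra.trace_algebraMap, hdeg, h3, map_smul, ← ht] at h1
      simp at h1
      have h4 : -(2 * x) = q * t := by
        apply Int.cast_injective (α := ℚ)
        push_cast
        linarith
      have h5 := congrArg (Int.cast : ℤ → ZMod q) h4
      push_cast at h5
      rw [ZMod.natCast_self, zero_mul, neg_eq_zero] at h5
      exact mul_ne_zero two0 hx0 h5
  obtain ⟨s, r, hsr⟩ := neg_pell p hp hp4
  have hcore := core p q hpq hp4 hq4 hsq (x : ZMod q) hx s r hsr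
  have hsr' : (s : 𝓞 K) ^ 2 + 1 = p * r ^ 2 := by exact_mod_cast congrArg (Int.cast : ℤ → 𝓞 K) hsr
  let η : (𝓞 K)ˣ := ⟨s + r * a, -(s - r * a),
    by linear_combination r ^ 2 * ha2 - hsr', by linear_combination r ^ 2 * ha2 - hsr'⟩
  have hη : (η : 𝓞 K) = s + r * a := rfl
  obtain ⟨n, hn⟩ := hε η
  have hodd : Odd n := by
    by_contra hne
    rw [Int.not_odd_iff_even] at hne
    obtain ⟨k, rfl⟩ := hne
    obtain ⟨u, v, huv⟩ := hspan (((ε ^ k : (𝓞 K)ˣ) : 𝓞 K) : K)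
    have hηK : (((η : 𝓞 K)) : K) = s + r * α := by
      rw [hη, ← ha]; push_cast; rfl
    have hfin : ∀ σ : ℚ, σ ^ 2 = 1 → (s : K) + r * α = σ * ((u : K) + v * α) ^ 2 → False := by
      intro σ hσ h
      obtain ⟨h1, h2⟩ := hlin (s - σ * (u ^ 2 + p * v ^ 2)) (r - σ * (2 * u * v)) (by
        push_cast; linear_combination h + σ * v ^ 2 * hα)
      have hsrQ : (s : ℚ) ^ 2 + 1 = p * r ^ 2 := by exact_mod_cast hsr
      have hneg : (u ^ 2 - p * v ^ 2) ^ 2 = (-1 : ℚ) := by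
        have e1 : (s : ℚ) = σ * (u ^ 2 + p * v ^ 2) := by linear_combination h1
        have e2 : (r : ℚ) = σ * (2 * u * v) := by linear_combination h2
        rw [e1, e2] at hsrQ
        linear_combination hsrQ - (u ^ 2 - p * v ^ 2) ^ 2 * hσ
      nlinarith [sq_nonneg (u ^ 2 - p * v ^ 2)]
    rw [zpow_add] at hn
    rcases hn with hn | hn
    · apply hfin 1 (by norm_num)
      rw [← hηK, ← huv, hn]; push_cast; ring
    · apply hfin (-1) (by norm_num)
      rw [← hηK, ← huv, hn]; push_cast; ring
  have hbot : 𝔮 ≠ ⊥ := by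
    rintro rfl; rw [Ideal.absNorm_bot] at hN; omega
  have hmax : 𝔮.IsMaximal := h𝔮.isMaximal hbot
  letI : Field (𝓞 K ⧸ 𝔮) := Ideal.Quotient.field 𝔮
  haveI : Finite (𝓞 K ⧸ 𝔮) := Ideal.finiteQuotientOfFreeOfNeBot 𝔮 hbot
  letI : Fintype (𝓞 K ⧸ 𝔮) := Fintype.ofFinite _
  have hcard : Fintype.card (𝓞 K ⧸ 𝔮) = q := by
    rw [← Nat.card_eq_fintype_card, ← hN, Ideal.absNorm_apply]; rfl
  let π := Ideal.Quotient.mk 𝔮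
  obtain ⟨M, hM⟩ : ∃ m, q = 4 * m + 1 := ⟨q / 4, by omega⟩
  have E2 : (q - 1) / 2 = 2 * M := by omega
  have hpow : ∀ u : (𝓞 K ⧸ 𝔮)ˣ, (u ^ (2 * M)) ^ 2 = 1 := by
    intro u
    rw [← pow_mul, show 2 * M * 2 = q - 1 by omega]
    ext
    push_cast
    rw [← hcard]
    exact FiniteField.pow_card_sub_one_eq_one _ u.ne_zero
  let E : (𝓞 K)ˣ →* (𝓞 K ⧸ 𝔮)ˣ := Units.map π
  have hEη : (E η) ^ (2 * M) = (E ε) ^ (2 * M) := by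
    have hE : (E η) ^ (2 * M) = ((E ε) ^ (2 * M)) ^ n := by
      have : η ^ (2 * M) = (ε ^ (2 * M)) ^ n := by
        have hc : (ε ^ n) ^ (2 * M) = (ε ^ (2 * M)) ^ n := by
          rw [← zpow_natCast, ← zpow_natCast, ← zpow_mul, ← zpow_mul, mul_comm]
        rcases hn with hn | hn
        · rw [hn, hc]
        · rw [hn, Even.neg_pow (by simp), hc]
      rw [← map_pow, this, map_zpow, map_pow]
    obtain ⟨k, hk⟩ := hodd
    rw [hE, hk, zpow_add, zpow_mul, zpow_one]
    have := hpow (E ε)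
    rw [show ((E ε) ^ (2 * M)) ^ (2 : ℤ) = 1 by exact_mod_cast this, one_zpow, one_mul]
  have hσ : π (ε : 𝓞 K) ^ (2 * M) = ((quarticSym p q * quarticSym q p : ℤ) : 𝓞 K ⧸ 𝔮) := by
    have h1 : π (ε : 𝓞 K) ^ (2 * M) = π (η : 𝓞 K) ^ (2 * M) := by
      have := congrArg Units.val hEη
      push_cast at this
      exact this.symm
    have h2 : π a = π (x : 𝓞 K) := Ideal.Quotient.eq.mpr hxa
    have h3 : π (((s + r * x) ^ (2 * M) - quarticSym p q * quarticSym q p : ℤ) : 𝓞 K) = 0 := by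
      rw [Ideal.Quotient.eq_zero_iff_mem]
      apply hintmem
      rw [E2] at hcore
      push_cast at hcore ⊢
      rw [hcore, sub_self]
    rw [h1, hη, map_add, map_mul, h2]
    push_cast at h3 ⊢
    simp only [map_sub, map_mul, map_pow, map_add, map_intCast] at h3 ⊢
    exact sub_eq_zero.mp h3
  have hpm : quarticSym p q * quarticSym q p = 1 ∨ quarticSym p q * quarticSym q p = -1 := by
    unfold quarticSym; split_ifs <;> simp
  unfold quadResSym
  rw [hN, E2]
  have hiff : (ε : 𝓞 K) ^ (2 * M) - 1 ∈ 𝔮 ↔ π (ε : 𝓞 K) ^ (2 * M) = 1 := by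
    rw [← Ideal.Quotient.eq_zero_iff_mem, map_sub, map_pow, map_one, sub_eq_zero]
  rcases hpm with h | h
  · rw [h] at hσ ⊢
    rw [if_pos (hiff.mpr (by simpa using hσ))]
  · rw [h] at hσ ⊢
    rw [if_neg]
    intro hc
    rw [hiff, hσ] at hc
    have hch : (2 : 𝓞 K ⧸ 𝔮) = 0 := by
      push_cast at hc; linear_combination -hc
    have h2m : ((2 : 𝓞 K)) ∈ 𝔮 := by
      rw [← Ideal.Quotient.eq_zero_iff_mem]; exact_mod_cast hch
    apply h𝔮.ne_top
    rw [Ideal.eq_top_iff_one]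
    have : (1 : 𝓞 K) = q - 2 * (2 * M : ℕ) := by
      rw [hM]; push_cast; ring
    rw [this]
    exact 𝔮.sub_mem h𝔮q (𝔮.mul_mem_right _ h2m)

/-- The strong form of Scholz's reciprocity law over `ℚ`: for distinct primes
`p ≡ q ≡ 1 mod 4` with `(p/q) = 1`, `(ε_p/q) = (ε_q/p) = (p/q)₄ (q/p)₄`. -/
theorem scholz_reciprocity_strong_form
    (p q : ℕ) (hp : p.Prime) (hq : q.Prime) (hpq : p ≠ q)
    [Fact p.Prime] [Fact q.Prime]
    (hp4 : p % 4 = 1) (hq4 : q % 4 = 1)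
    (hleg : legendreSym q p = 1)     -- `(p/q) = +1`
    (Kp : Type*) [Field Kp] [NumberField Kp]
    (hdegp : Module.finrank ℚ Kp = 2)
    (αp : Kp) (hαp : αp ^ 2 = (p : Kp))   -- `Kp = ℚ(√p)`
    (Kq : Type*) [Field Kq] [NumberField Kq]
    (hdegq : Module.finrank ℚ Kq = 2)
    (αq : Kq) (hαq : αq ^ 2 = (q : Kq))   -- `Kq = ℚ(√q)`
    (εp : (𝓞 Kp)ˣ)
    (hεp : ∀ u : (𝓞 Kp)ˣ, ∃ n : ℤ, u = εp ^ n ∨ u = -εp ^ n)  -- fundamental unit of `ℚ(√p)`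
    (εq : (𝓞 Kq)ˣ)
    (hεq : ∀ u : (𝓞 Kq)ˣ, ∃ n : ℤ, u = εq ^ n ∨ u = -εq ^ n)  -- fundamental unit of `ℚ(√q)`
    (𝔮 : Ideal (𝓞 Kp)) (h𝔮 : 𝔮.IsPrime) (h𝔮q : (q : 𝓞 Kp) ∈ 𝔮)  -- `𝔮` lies above `q`
    (𝔭 : Ideal (𝓞 Kq)) (h𝔭 : 𝔭.IsPrime) (h𝔭p : (p : 𝓞 Kq) ∈ 𝔭)  -- `𝔭` lies above `p`
    : quadResSym Kp 𝔮 (εp : 𝓞 Kp) = quadResSym Kq 𝔭 (εq : 𝓞 Kq) ∧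
      quadResSym Kp 𝔮 (εp : 𝓞 Kp) = quarticSym p q * quarticSym q p := by
  have hsq' : IsSquare (p : ZMod q) := by
    have h0 : ((p : ℤ) : ZMod q) ≠ 0 := by
      intro h
      rw [(legendreSym.eq_zero_iff q p).mpr h] at hleg
      exact zero_ne_one hleg
    have := (legendreSym.eq_one_iff q h0).mp hleg
    exact_mod_cast this
  have hsq : IsSquare (q : ZMod p) :=
    (ZMod.exists_sq_eq_prime_iff_of_mod_four_eq_one hp4 (by rintro rfl; omega)).mpr hsq'
  have h1 := side p q hpq hp4 hq4 hsq hsq' Kp hdegp αp hαp εp hεp 𝔮 h𝔮 h𝔮q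
  have h2 := side q p hpq.symm hq4 hp4 hsq' hsq Kq hdegq αq hαq εq hεq 𝔭 h𝔭 h𝔭p
  exact ⟨by rw [h1, h2, mul_comm], h1⟩
end
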